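/- arXiv:0710.1950 — 6 statements merged into one kernel-verified Lean document; each statement's English description precedes it below -/
import Mathlib

section
/- Let s < −1 and let u ∈ L^{2,s}(ℝ²) be a weak solution of the homogeneous Helmholtz equation Δu + k² n(x)² u = 0 in ℝ². Let γ_* ∈ (0, d²). Then for every fixed z ∈ ℝ, lim_{|x| → ∞} u(x,z) e^{−|x| √(d² − γ_*)} = 0 and lim_{|x| → ∞} u_x(x,z) e^{−|x| √(d² − γ_*)} = 0, where u_x denotes the partial derivative of u with respect to x. -/
open MeasureTheory Filter Set Complex
open scoped ENNReal NNReal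

noncomputable section

/-- Partial derivative in the first variable of a complex-valued function on `ℝ × ℝ`. -/
def pdx (u : ℝ × ℝ → ℂ) (p : ℝ × ℝ) : ℂ := deriv (fun t => u (t, p.2)) p.1

/-- Partial derivative in the second variable of a complex-valued function on `ℝ × ℝ`. -/
def pdz (u : ℝ × ℝ → ℂ) (p : ℝ × ℝ) : ℂ := deriv (fun t => u (p.1, t)) p.2

/-- Partial derivative in the first variable of a real-valued function on `ℝ × ℝ`. -/
def pdxR (F : ℝ × ℝ → ℝ) (p : ℝ × ℝ) : ℝ := deriv (fun t => F (t, p.2)) p.1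

/-- Partial derivative in the second variable of a real-valued function on `ℝ × ℝ`. -/
def pdzR (F : ℝ × ℝ → ℝ) (p : ℝ × ℝ) : ℝ := deriv (fun t => F (p.1, t)) p.2

/-- Smooth compactly supported real-valued test function on `ℝ × ℝ`. -/
def IsTest (φ : ℝ × ℝ → ℝ) : Prop := ContDiff ℝ (⊤ : ℕ∞) φ ∧ HasCompactSupport φ

/-- Weak solution (continuously differentiable by elliptic regularity) of the homogeneous
Helmholtz equation `Δu + k² n(x)² u = 0` on `ℝ²`:
`∫ ∇u·∇φ = k² ∫ n² u φ` for all test functions. -/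
def IsWeakSol0 (k : ℝ) (n : ℝ → ℝ) (u : ℝ × ℝ → ℂ) : Prop :=
  ContDiff ℝ 1 u ∧
  ∀ φ : ℝ × ℝ → ℝ, IsTest φ →
    (∫ p : ℝ × ℝ, (pdx u p * (pdxR φ p : ℂ) + pdz u p * (pdzR φ p : ℂ))) =
      (k : ℂ) ^ 2 * ∫ p : ℝ × ℝ, ((n p.1 : ℝ) : ℂ) ^ 2 * u p * (φ p : ℂ)

/-- Membership in the weighted space `L^{2,s}(ℝ²)`. -/
def MemL2s (s : ℝ) (u : ℝ × ℝ → ℂ) : Prop :=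
  (∫⁻ p : ℝ × ℝ, ENNReal.ofReal ((1 + p.1 ^ 2 + p.2 ^ 2) ^ s) * (‖u p‖₊ : ℝ≥0∞) ^ 2) < ⊤

lemma pdx_eq {u : ℝ × ℝ → ℂ} {p : ℝ × ℝ} (hu : DifferentiableAt ℝ u p) :
    pdx u p = fderiv ℝ u p (1, 0) := by
  have h1 : HasDerivAt (fun t : ℝ => ((t, p.2) : ℝ × ℝ)) (1, 0) p.1 :=
    (hasDerivAt_id p.1).prodMk (hasDerivAt_const p.1 p.2)
  exact (HasFDerivAt.comp_hasDerivAt p.1 (f := fun t : ℝ => ((t, p.2) : ℝ × ℝ))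
    (l := u) hu.hasFDerivAt h1).deriv

lemma pdz_eq {u : ℝ × ℝ → ℂ} {p : ℝ × ℝ} (hu : DifferentiableAt ℝ u p) :
    pdz u p = fderiv ℝ u p (0, 1) := by
  have h1 : HasDerivAt (fun t : ℝ => ((p.1, t) : ℝ × ℝ)) (0, 1) p.2 :=
    (hasDerivAt_const p.2 p.1).prodMk (hasDerivAt_id p.2)
  exact (HasFDerivAt.comp_hasDerivAt p.2 (f := fun t : ℝ => ((p.1, t) : ℝ × ℝ))
    (l := u) hu.hasFDerivAt h1).deriv

lemma pdxR_eq {u : ℝ × ℝ → ℝ} {p : ℝ × ℝ} (hu : DifferentiableAt ℝ u p) :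
    pdxR u p = fderiv ℝ u p (1, 0) := by
  have h1 : HasDerivAt (fun t : ℝ => ((t, p.2) : ℝ × ℝ)) (1, 0) p.1 :=
    (hasDerivAt_id p.1).prodMk (hasDerivAt_const p.1 p.2)
  exact (HasFDerivAt.comp_hasDerivAt p.1 (f := fun t : ℝ => ((t, p.2) : ℝ × ℝ))
    (l := u) hu.hasFDerivAt h1).deriv

lemma pdzR_eq {u : ℝ × ℝ → ℝ} {p : ℝ × ℝ} (hu : DifferentiableAt ℝ u p) :
    pdzR u p = fderiv ℝ u p (0, 1) := by
  have h1 : HasDerivAt (fun t : ℝ => ((p.1, t) : ℝ × ℝ)) (0, 1) p.2 :=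
    (hasDerivAt_const p.2 p.1).prodMk (hasDerivAt_id p.2)
  exact (HasFDerivAt.comp_hasDerivAt p.2 (f := fun t : ℝ => ((p.1, t) : ℝ × ℝ))
    (l := u) hu.hasFDerivAt h1).deriv

lemma pdx_cont {u : ℝ × ℝ → ℂ} (hu : ContDiff ℝ 1 u) : Continuous (pdx u) := by
  have : pdx u = fun p => fderiv ℝ u p (1, 0) :=
    funext fun p => pdx_eq (hu.differentiable one_ne_zero p)
  rw [this]
  exact (hu.continuous_fderiv one_ne_zero).clm_apply continuous_const

lemma pdz_cont {u : ℝ × ℝ → ℂ} (hu : ContDiff ℝ 1 u) : Continuous (pdz u) := by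
  have : pdz u = fun p => fderiv ℝ u p (0, 1) :=
    funext fun p => pdz_eq (hu.differentiable one_ne_zero p)
  rw [this]
  exact (hu.continuous_fderiv one_ne_zero).clm_apply continuous_const

/-- chain rule along a curve -/
lemma chain_curve {u : ℝ × ℝ → ℂ} (hu : ContDiff ℝ 1 u) {g : ℝ → ℝ × ℝ} {a b t : ℝ}
    (hg : HasDerivAt g (a, b) t) :
    HasDerivAt (fun t => u (g t)) (pdx u (g t) * a + pdz u (g t) * b) t := by
  have hd := hu.differentiable one_ne_zero (g t)
  have h2 := HasFDerivAt.comp_hasDerivAt t (f := g) (l := u) hd.hasFDerivAt hg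
  rw [pdx_eq hd, pdz_eq hd]
  have : ((a, b) : ℝ × ℝ) = a • (1, 0) + b • (0, 1) := by simp
  have h3 : fderiv ℝ u (g t) (a, b)
      = fderiv ℝ u (g t) (1, 0) * a + fderiv ℝ u (g t) (0, 1) * b := by
    rw [this, map_add, map_smul, map_smul]
    simp [mul_comm]
  rw [← h3]
  exact h2

/-- the unit box -/
def Bx : Set (ℝ × ℝ) := Icc (-1) 1 ×ˢ Icc (-1) 1

lemma Bx_compact : IsCompact Bx := isCompact_Icc.prod isCompact_Icc

/-- squared euclidean norm -/
def NN (q : ℝ × ℝ) : ℝ := q.1 ^ 2 + q.2 ^ 2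

lemma NN_contDiff : ContDiff ℝ (⊤ : ℕ∞) NN := by unfold NN; fun_prop

lemma NN_cont : Continuous NN := NN_contDiff.continuous

lemma NN_nonneg (q) : 0 ≤ NN q := by unfold NN; positivity

lemma mem_Bx_of_NN {q : ℝ × ℝ} (h : NN q ≤ 1) : q ∈ Bx := by
  unfold NN at h
  refine ⟨⟨?_, ?_⟩, ⟨?_, ?_⟩⟩ <;> nlinarith [sq_nonneg q.1, sq_nonneg q.2]

lemma cs_of_Bx {E : Type*} [Zero E] {f : ℝ × ℝ → E} (h : ∀ q, q ∉ Bx → f q = 0) :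
    HasCompactSupport f := HasCompactSupport.intro Bx_compact h

lemma int_of_Bx {E : Type*} [NormedAddCommGroup E] {f : ℝ × ℝ → E} (hc : Continuous f)
    (h : ∀ q, q ∉ Bx → f q = 0) : Integrable f :=
  hc.integrable_of_hasCompactSupport (cs_of_Bx h)

/-- differentiation under the integral -/
lemma deriv_under {F F' : ℝ → ℝ × ℝ → ℂ} (hF : ∀ t, Continuous (F t))
    (hF' : Continuous fun p : ℝ × (ℝ × ℝ) => F' p.1 p.2)
    (hz : ∀ t, ∀ q, q ∉ Bx → F t q = 0) (hz' : ∀ t, ∀ q, q ∉ Bx → F' t q = 0)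
    (hd : ∀ t q, HasDerivAt (fun t => F t q) (F' t q) t) (t : ℝ) :
    HasDerivAt (fun t => ∫ q, F t q) (∫ q, F' t q) t := by
  obtain ⟨C, hC⟩ := ((isCompact_Icc (a := t - 1) (b := t + 1)).prod Bx_compact).exists_bound_of_continuousOn
    hF'.continuousOn
  refine (hasDerivAt_integral_of_dominated_loc_of_deriv_le (s := Icc (t-1) (t+1))
    (bound := Bx.indicator fun _ => C) (Icc_mem_nhds (by linarith) (by linarith)) ?_ ?_ ?_ ?_ ?_ ?_).2
  · exact Eventually.of_forall fun x => (hF x).aestronglyMeasurable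
  · exact int_of_Bx (hF t) (hz t)
  · exact (hF'.comp (by fun_prop : Continuous fun q : ℝ × ℝ => (t, q))).aestronglyMeasurable
  · refine Eventually.of_forall fun q x hx => ?_
    by_cases hq : q ∈ Bx
    · rw [indicator_of_mem hq]
      exact hC (x, q) ⟨hx, hq⟩
    · rw [hz' x q hq, indicator_of_notMem hq]; simp
  · rw [integrable_indicator_iff Bx_compact.measurableSet]
    exact integrableOn_const Bx_compact.measure_lt_top.ne
  · exact Eventually.of_forall fun q x _ => hd x q

/-- radial profiles -/
def Prof (η : ℝ → ℝ) : Prop := ContDiff ℝ (⊤ : ℕ∞) η ∧ ∀ s, 1 ≤ s → η s = 0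

lemma Prof.zero {η : ℝ → ℝ} (h : Prof η) {q : ℝ × ℝ} (hq : q ∉ Bx) : η (NN q) = 0 := by
  apply h.2
  by_contra hc
  exact hq (mem_Bx_of_NN (not_le.1 hc).le)

/-- primitive operator -/
def TT (η : ℝ → ℝ) (s : ℝ) : ℝ := (1 / 2) * ∫ t in (1 : ℝ)..s, η t

lemma TT_deriv {η : ℝ → ℝ} (h : Prof η) (s : ℝ) : HasDerivAt (TT η) (1 / 2 * η s) s := by
  have hc := h.1.continuous
  exact (intervalIntegral.integral_hasDerivAt_right (hc.intervalIntegrable _ _)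
    (hc.stronglyMeasurableAtFilter _ _) hc.continuousAt).const_mul _

lemma TT_prof {η : ℝ → ℝ} (h : Prof η) : Prof (TT η) := by
  constructor
  · rw [contDiff_infty_iff_deriv]
    refine ⟨fun s => (TT_deriv h s).differentiableAt, ?_⟩
    have : deriv (TT η) = fun s => 1 / 2 * η s := funext fun s => (TT_deriv h s).deriv
    rw [this]
    exact contDiff_const.mul h.1
  · intro s hs
    unfold TT
    rw [intervalIntegral.integral_congr (g := fun _ => 0)]
    · simp
    · intro t ht
      rw [uIcc_of_le hs] at ht
      exact h.2 t ht.1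

lemma TT_bound {η : ℝ → ℝ} {S : ℝ} (hS : ∀ s, 0 ≤ s → |η s| ≤ S) :
    ∀ s, 0 ≤ s → Prof η → |TT η s| ≤ S := by
  intro s hs h
  have hS0 : 0 ≤ S := (abs_nonneg _).trans (hS 0 le_rfl)
  rcases le_total 1 s with h1 | h1
  · rw [(TT_prof h).2 s h1]; simpa using hS0
  · have := intervalIntegral.norm_integral_le_of_norm_le_const (a := 1) (b := s) (f := η) (C := S) (by
      intro x hx
      rw [uIoc_of_ge h1] at hx
      exact hS x (hs.trans hx.1.le))
    rw [Real.norm_eq_abs] at this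
    unfold TT
    rw [abs_mul]
    have h2 : |s - 1| ≤ 1 := by rw [abs_le]; constructor <;> linarith
    have h3 : |(1:ℝ)/2| = 1/2 := by norm_num
    rw [h3]
    nlinarith

/-- local (constant coefficient) weak solution in `|x| > h` -/
def LS (κ h : ℝ) (u : ℝ × ℝ → ℂ) : Prop :=
  ContDiff ℝ 1 u ∧
  ∀ φ : ℝ × ℝ → ℝ, IsTest φ → (∀ y : ℝ × ℝ, |y.1| ≤ h → φ y = 0) →
    (∫ p : ℝ × ℝ, (pdx u p * (pdxR φ p : ℂ) + pdz u p * (pdzR φ p : ℂ))) =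
      (κ : ℂ) ^ 2 * ∫ p : ℝ × ℝ, u p * (φ p : ℂ)

/-- weighted means -/
def AA (u : ℝ × ℝ → ℂ) (p : ℝ × ℝ) (η : ℝ → ℝ) (t : ℝ) : ℂ :=
  ∫ q : ℝ × ℝ, u (p + t • q) * (η (NN q) : ℂ)

/-- derivative of weighted means -/
def AD (u : ℝ × ℝ → ℂ) (p : ℝ × ℝ) (η : ℝ → ℝ) (t : ℝ) : ℂ :=
  ∫ q : ℝ × ℝ, (pdx u (p + t • q) * (q.1 : ℂ) + pdz u (p + t • q) * (q.2 : ℂ)) * (η (NN q) : ℂ)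

lemma AA_deriv {u : ℝ × ℝ → ℂ} (hu : ContDiff ℝ 1 u) (p : ℝ × ℝ) {η : ℝ → ℝ} (hη : Prof η)
    (t : ℝ) : HasDerivAt (AA u p η) (AD u p η t) t := by
  have c1 := hu.continuous
  have c2 := pdx_cont hu
  have c3 := pdz_cont hu
  have c4 := hη.1.continuous
  have c5 := NN_cont
  refine deriv_under (F := fun t q => u (p + t • q) * (η (NN q) : ℂ))
    (F' := fun t q => (pdx u (p + t • q) * (q.1 : ℂ) + pdz u (p + t • q) * (q.2 : ℂ))
      * (η (NN q) : ℂ)) ?_ ?_ ?_ ?_ ?_ t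
  · intro t; fun_prop
  · fun_prop
  · intro t q hq; simp [hη.zero hq]
  · intro t q hq; simp [hη.zero hq]
  · intro t q
    refine HasDerivAt.mul_const ?_ _
    refine chain_curve hu (g := fun t => p + t • q) ?_
    have := ((hasDerivAt_id t).smul_const q).const_add p
    simpa using this

lemma change_var (p : ℝ × ℝ) {t : ℝ} (ht : t ≠ 0) : ∃ c : ℝ, c ≠ 0 ∧
    ∀ f : ℝ × ℝ → ℂ, ∫ q, f (p + t • q) = (c : ℂ) * ∫ y, f y := by
  refine ⟨|(t ^ Module.finrank ℝ (ℝ × ℝ))⁻¹|, by positivity, fun f => ?_⟩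
  rw [Measure.integral_comp_smul volume (fun q => f (p + q)) t, integral_add_left_eq_self]
  simp

lemma AD_eq {κ h : ℝ} {u : ℝ × ℝ → ℂ} (hu : LS κ h u) {p : ℝ × ℝ} (hp : h + 1 < |p.1|)
    {η : ℝ → ℝ} (hη : Prof η) {t : ℝ} (ht0 : 0 ≤ t) (ht1 : t ≤ 1) :
    AD u p η t = (κ : ℂ) ^ 2 * t * AA u p (TT η) t := by
  rcases ht0.eq_or_lt with rfl | ht
  · have : AD u p η 0 = - AD u p η 0 := by
      unfold AD
      conv_lhs => rw [← integral_neg_eq_self]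
      rw [← integral_neg]
      congr 1
      ext q
      have : NN (-q) = NN q := by simp [NN]
      rw [this]
      simp
      ring
    have h0 : AD u p η 0 = 0 := self_eq_neg.1 this
    rw [h0]; simp
  · have hT := TT_prof hη
    set φ : ℝ × ℝ → ℝ := fun y => TT η (NN (t⁻¹ • (y - p))) with hφ
    have key : ∀ q, φ (p + t • q) = TT η (NN q) := by
      intro q
      simp only [hφ, add_sub_cancel_left, smul_smul, inv_mul_cancel₀ ht.ne', one_smul]
    have hsm : ContDiff ℝ (⊤ : ℕ∞) φ := by
      have := hT.1
      have := NN_contDiff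
      fun_prop
    have hzero : ∀ y, t⁻¹ • (y - p) ∉ Bx → φ y = 0 := fun y hy => hT.zero hy
    have hcs : HasCompactSupport φ := by
      refine HasCompactSupport.intro (K := (fun q => p + t • q) '' Bx)
        (Bx_compact.image (by fun_prop)) ?_
      intro y hy
      apply hzero
      intro hc
      exact hy ⟨_, hc, by simp [smul_smul, mul_inv_cancel₀ ht.ne']⟩
    have hloc : ∀ y : ℝ × ℝ, |y.1| ≤ h → φ y = 0 := by
      intro y hy
      apply hzero
      intro hc
      have h1 : |t⁻¹ * (y.1 - p.1)| ≤ 1 := abs_le.2 hc.1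
      rw [abs_mul, abs_inv, abs_of_pos ht, inv_mul_le_iff₀ ht] at h1
      have h2 : |p.1| ≤ |y.1| + |y.1 - p.1| := by
        have := abs_sub_abs_le_abs_sub p.1 y.1
        rw [abs_sub_comm] at this
        linarith
      linarith
    have hpx : ∀ q, pdxR φ (p + t • q) = t⁻¹ * (q.1 * η (NN q)) := by
      intro q
      refine HasDerivAt.deriv ?_
      have h0 : HasDerivAt (fun s : ℝ => NN (t⁻¹ • (((s, (p + t • q).2) : ℝ × ℝ) - p)))
          (t⁻¹ * (2 * q.1)) (p + t • q).1 := by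
        simp only [NN, Prod.smul_fst, Prod.fst_sub, Prod.smul_snd, Prod.snd_sub, smul_eq_mul]
        have := ((((hasDerivAt_id (p + t • q).1).sub_const p.1).const_mul t⁻¹).pow 2).add_const
          ((t⁻¹ * ((p + t • q).2 - p.2)) ^ 2)
        refine this.congr_deriv ?_
        simp
        field_simp
      have h1 := TT_deriv hη (NN q)
      have h2 : NN (t⁻¹ • ((((p + t • q).1, (p + t • q).2) : ℝ × ℝ) - p)) = NN q := by
        simp only [Prod.mk.eta, add_sub_cancel_left, smul_smul, inv_mul_cancel₀ ht.ne', one_smul]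
      refine (HasDerivAt.comp_of_eq _ h1 h0 h2.symm).congr_deriv ?_
      ring
    have hpz : ∀ q, pdzR φ (p + t • q) = t⁻¹ * (q.2 * η (NN q)) := by
      intro q
      refine HasDerivAt.deriv ?_
      have h0 : HasDerivAt (fun s : ℝ => NN (t⁻¹ • ((((p + t • q).1, s) : ℝ × ℝ) - p)))
          (t⁻¹ * (2 * q.2)) (p + t • q).2 := by
        simp only [NN, Prod.smul_fst, Prod.fst_sub, Prod.smul_snd, Prod.snd_sub, smul_eq_mul]
        have := ((((hasDerivAt_id (p + t • q).2).sub_const p.2).const_mul t⁻¹).pow 2).const_add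
          ((t⁻¹ * ((p + t • q).1 - p.1)) ^ 2)
        refine this.congr_deriv ?_
        simp
        field_simp
      have h1 := TT_deriv hη (NN q)
      have h2 : NN (t⁻¹ • ((((p + t • q).1, (p + t • q).2) : ℝ × ℝ) - p)) = NN q := by
        simp only [Prod.mk.eta, add_sub_cancel_left, smul_smul, inv_mul_cancel₀ ht.ne', one_smul]
      refine (HasDerivAt.comp_of_eq _ h1 h0 h2.symm).congr_deriv ?_
      ring
    have hw := hu.2 φ ⟨hsm, hcs⟩ hloc
    obtain ⟨c, hc0, hc⟩ := change_var p ht.ne'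
    have e1 := hc (fun p : ℝ × ℝ => (pdx u p * (pdxR φ p : ℂ) + pdz u p * (pdzR φ p : ℂ)))
    have e2 := hc (fun p : ℝ × ℝ => u p * (φ p : ℂ))
    rw [hw] at e1
    have e3 : (∫ q, (pdx u (p + t • q) * (pdxR φ (p + t • q) : ℂ)
        + pdz u (p + t • q) * (pdzR φ (p + t • q) : ℂ))) = (t⁻¹ : ℂ) * AD u p η t := by
      unfold AD
      rw [← integral_const_mul]
      congr 1
      ext q
      rw [hpx, hpz]
      push_cast
      ring
    have e4 : (∫ q, u (p + t • q) * (φ (p + t • q) : ℂ)) = AA u p (TT η) t := by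
      unfold AA
      simp only [key]
    rw [e3] at e1
    rw [e4] at e2
    have ht' : (t : ℂ) ≠ 0 := by exact_mod_cast ht.ne'
    rw [e2]
    calc AD u p η t = t * ((t⁻¹ : ℂ) * AD u p η t) := by field_simp
      _ = _ := by rw [e1]; ring

lemma AA_zero {κ h : ℝ} {u : ℝ × ℝ → ℂ} (hu : LS κ h u) {p : ℝ × ℝ} (hp : h + 1 < |p.1|)
    (hup : u p = 0) {δ : ℝ} (hδ0 : 0 ≤ δ) (hδ1 : δ ≤ 1) (hδ : κ ^ 2 * δ ^ 2 ≤ 1 / 2)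
    {η : ℝ → ℝ} (hη : Prof η) : AA u p η δ = 0 := by
  have c1 := hu.1.continuous
  obtain ⟨M, hM⟩ := ((isCompact_Icc (a := (0:ℝ)) (b := 1)).prod Bx_compact).exists_bound_of_continuousOn
    (f := fun r : ℝ × (ℝ × ℝ) => u (p + r.1 • r.2)) (by fun_prop)
  have hM0 : 0 ≤ M := (norm_nonneg _).trans (hM (0, 0) ⟨by simp, mem_Bx_of_NN (by simp [NN])⟩)
  set V := (volume : Measure (ℝ × ℝ)).real Bx
  have main : ∀ m : ℕ, ∀ η : ℝ → ℝ, Prof η → ∀ S, (∀ s, 0 ≤ s → |η s| ≤ S) → ∀ t ∈ Icc 0 δ,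
      ‖AA u p η t‖ ≤ (1 / 2) ^ m * (M * V * S) := by
    intro m
    induction m with
    | zero =>
      intro η hη S hS t ht
      have hS0 : 0 ≤ S := (abs_nonneg _).trans (hS 0 le_rfl)
      have : AA u p η t = ∫ q in Bx, u (p + t • q) * (η (NN q) : ℂ) := by
        unfold AA
        rw [setIntegral_eq_integral_of_forall_compl_eq_zero]
        intro q hq; simp [hη.zero hq]
      rw [this]
      refine (norm_setIntegral_le_of_norm_le_const (C := M * S) Bx_compact.measure_lt_top ?_).trans ?_
      · intro q hq
        rw [norm_mul]
        refine mul_le_mul (hM (t, q) ⟨⟨ht.1, ht.2.trans hδ1⟩, hq⟩) ?_ (norm_nonneg _) hM0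
        simpa using hS _ (NN_nonneg q)
      · apply le_of_eq; simp only [V]; ring
    | succ m ih =>
      intro η hη S hS t ht
      have hS0 : 0 ≤ S := (abs_nonneg _).trans (hS 0 le_rfl)
      have hz : AA u p η 0 = 0 := by simp [AA, hup]
      have hV : 0 ≤ V := measureReal_nonneg
      set D := (1 / 2) ^ m * (M * V * S)
      have hD : 0 ≤ D := by positivity
      have := norm_image_sub_le_of_norm_deriv_le_segment' (f := AA u p η) (a := 0) (b := δ)
        (f' := AD u p η) (C := κ ^ 2 * δ * D)
        (fun x _ => (AA_deriv hu.1 p hη x).hasDerivWithinAt) (by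
          intro x hx
          rw [AD_eq hu hp hη hx.1 (hx.2.le.trans hδ1), norm_mul, norm_mul]
          have h1 := ih (TT η) (TT_prof hη) S (fun s hs => TT_bound hS s hs hη) x ⟨hx.1, hx.2.le⟩
          have h2 : ‖(x : ℂ)‖ ≤ δ := by
            rw [Complex.norm_real, Real.norm_eq_abs, abs_of_nonneg hx.1]; exact hx.2.le
          have h3 : ‖(κ : ℂ) ^ 2‖ = κ ^ 2 := by
            rw [norm_pow, Complex.norm_real, Real.norm_eq_abs, sq_abs]
          rw [h3]
          gcongr) t ht
      rw [hz, sub_zero, sub_zero] at this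
      refine this.trans ?_
      have h4 : κ ^ 2 * δ * D * t ≤ κ ^ 2 * δ * D * δ := by
        have := ht.2
        gcongr
      have h5 : κ ^ 2 * δ ^ 2 * D ≤ 1 / 2 * D := by gcongr
      calc _ ≤ _ := h4
        _ = κ ^ 2 * δ ^ 2 * D := by ring
        _ ≤ _ := h5
        _ = _ := by simp only [D]; ring
  obtain ⟨S, hS⟩ := (isCompact_Icc (a := (0:ℝ)) (b := 1)).exists_bound_of_continuousOn
    hη.1.continuous.continuousOn
  have hS' : ∀ s, 0 ≤ s → |η s| ≤ S := by
    intro s hs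
    rcases le_total s 1 with h1 | h1
    · exact hS s ⟨hs, h1⟩
    · rw [hη.2 s h1, abs_zero]; exact (norm_nonneg _).trans (hS 0 (by simp))
  have hle : ‖AA u p η δ‖ ≤ 0 := by
    have ht : Tendsto (fun m : ℕ => ((1:ℝ) / 2) ^ m * (M * V * S)) atTop (nhds (0 * (M * V * S))) :=
      (tendsto_pow_atTop_nhds_zero_of_lt_one (by norm_num) (by norm_num)).mul_const _
    rw [zero_mul] at ht
    exact ge_of_tendsto' ht fun m => main m η hη S hS' δ ⟨hδ0, le_rfl⟩
  simpa using hle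

lemma LS_of_sol {h k ncl : ℝ} {n : ℝ → ℝ} (hn_cl : ∀ x, h < |x| → n x = ncl)
    {u : ℝ × ℝ → ℂ} (hsol : IsWeakSol0 k n u) : LS (k * ncl) h u := by
  refine ⟨hsol.1, fun φ hφ hz => ?_⟩
  rw [hsol.2 φ hφ, ← integral_const_mul, ← integral_const_mul]
  congr 1
  ext y
  by_cases hy : |y.1| ≤ h
  · simp [hz y hy]
  · rw [hn_cl _ (not_le.1 hy)]
    push_cast; ring

lemma pdR_int {φ : ℝ × ℝ → ℝ} (hφ : IsTest φ) {f g : ℝ × ℝ → ℂ} (hf : Continuous f)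
    (hg : Continuous g) : Integrable fun p => f p * (pdxR φ p : ℂ) + g p * (pdzR φ p : ℂ) := by
  have hd : ∀ p, DifferentiableAt ℝ φ p := fun p => hφ.1.differentiable (by simp) p
  have e1 : pdxR φ = fun p => fderiv ℝ φ p (1, 0) := funext fun p => pdxR_eq (hd p)
  have e2 : pdzR φ = fun p => fderiv ℝ φ p (0, 1) := funext fun p => pdzR_eq (hd p)
  have hc : Continuous (fderiv ℝ φ) := hφ.1.continuous_fderiv (by simp)
  have s1 : HasCompactSupport (fderiv ℝ φ) := hφ.2.fderiv ℝ
  rw [e1, e2]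
  refine Continuous.integrable_of_hasCompactSupport ?_ ?_
  · fun_prop
  · refine s1.mono' ?_
    refine Function.support_subset_iff'.2 fun p hp => ?_
    simp [image_eq_zero_of_notMem_tsupport hp]

lemma mul_test_int {φ : ℝ × ℝ → ℝ} (hφ : IsTest φ) {f : ℝ × ℝ → ℂ} (hf : Continuous f) :
    Integrable fun p => f p * (φ p : ℂ) := by
  have := hφ.1.continuous
  refine Continuous.integrable_of_hasCompactSupport (by fun_prop) ?_
  refine hφ.2.mono ?_
  refine Function.support_subset_iff'.2 fun p hp => ?_
  rw [Function.notMem_support.1 hp]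
  simp

lemma LS_sub {κ h : ℝ} {u v : ℝ × ℝ → ℂ} (hu : LS κ h u) (hv : LS κ h v) (c : ℂ) :
    LS κ h (fun y => u y - c * v y) := by
  have hw : ContDiff ℝ 1 (fun y => u y - c * v y) := hu.1.sub (contDiff_const.mul hv.1)
  have du := fun y => hu.1.differentiable one_ne_zero y
  have dv := fun y => hv.1.differentiable one_ne_zero y
  have e : ∀ y, fderiv ℝ (fun y => u y - c * v y) y = fderiv ℝ u y - c • fderiv ℝ v y := by
    intro y
    exact ((du y).hasFDerivAt.sub ((dv y).hasFDerivAt.const_mul c)).fderiv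
  refine ⟨hw, fun φ hφ hz => ?_⟩
  have h1 := hu.2 φ hφ hz
  have h2 := hv.2 φ hφ hz
  have i1 := pdR_int hφ (pdx_cont hu.1) (pdz_cont hu.1)
  have i2 := pdR_int hφ (pdx_cont hv.1) (pdz_cont hv.1)
  have i3 := mul_test_int hφ hu.1.continuous
  have i4 := mul_test_int hφ hv.1.continuous
  calc _ = ∫ p : ℝ × ℝ, ((pdx u p * (pdxR φ p : ℂ) + pdz u p * (pdzR φ p : ℂ))
        - c * (pdx v p * (pdxR φ p : ℂ) + pdz v p * (pdzR φ p : ℂ))) := by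
        congr 1; ext p
        rw [pdx_eq (hw.differentiable one_ne_zero p), pdz_eq (hw.differentiable one_ne_zero p), e,
          pdx_eq (du p), pdz_eq (du p), pdx_eq (dv p), pdz_eq (dv p)]
        simp
        ring
    _ = (κ : ℂ) ^ 2 * (∫ p, u p * (φ p : ℂ)) - c * ((κ : ℂ) ^ 2 * ∫ p, v p * (φ p : ℂ)) := by
        rw [integral_sub i1 (i2.const_mul c), integral_const_mul, h1, h2]
    _ = (κ : ℂ) ^ 2 * ∫ p, (u p * (φ p : ℂ) - c * (v p * (φ p : ℂ))) := by
        rw [integral_sub i3 (i4.const_mul c), integral_const_mul]; ring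
    _ = _ := by
        congr 2; ext p; ring

lemma LS_cos (κ h a : ℝ) : LS κ h (fun y => ((Real.cos (κ * (y.1 - a)) : ℝ) : ℂ)) := by
  constructor
  · have : ContDiff ℝ 1 (fun y : ℝ × ℝ => Real.cos (κ * (y.1 - a))) := by fun_prop
    exact Complex.ofRealCLM.contDiff.comp this
  intro φ hφ hz
  have e1 : ∀ p : ℝ × ℝ, pdx (fun y => ((Real.cos (κ * (y.1 - a)) : ℝ) : ℂ)) p
      = ((-κ * Real.sin (κ * (p.1 - a)) : ℝ) : ℂ) := by
    intro p
    refine HasDerivAt.deriv ?_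
    have h0 : HasDerivAt (fun t : ℝ => κ * (t - a)) (κ * 1) p.1 :=
      ((hasDerivAt_id p.1).sub_const a).const_mul κ
    refine (h0.cos.congr_deriv ?_).ofReal_comp
    ring
  have e2 : ∀ p : ℝ × ℝ, pdz (fun y => ((Real.cos (κ * (y.1 - a)) : ℝ) : ℂ)) p = 0 := by
    intro p
    simp [pdz]
  have hd : ∀ p, DifferentiableAt ℝ φ p := fun p => hφ.1.differentiable (by simp) p
  have hc : Continuous (fderiv ℝ φ) := hφ.1.continuous_fderiv (by simp)
  have hc0 := hφ.1.continuous
  have s1 : HasCompactSupport (fderiv ℝ φ) := hφ.2.fderiv ℝ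
  set f : ℝ × ℝ → ℝ := fun y => -κ * Real.sin (κ * (y.1 - a)) with hf
  have fd : ∀ y, DifferentiableAt ℝ f y := by intro y; simp only [hf]; fun_prop
  have fc : Continuous f := by simp only [hf]; fun_prop
  have e3 : ∀ y, fderiv ℝ f y (1, 0) = - κ ^ 2 * Real.cos (κ * (y.1 - a)) := by
    intro y
    rw [← pdxR_eq (fd y)]
    refine HasDerivAt.deriv ?_
    have h0 : HasDerivAt (fun t : ℝ => κ * (t - a)) (κ * 1) y.1 :=
      ((hasDerivAt_id y.1).sub_const a).const_mul κ
    refine (h0.sin.const_mul (-κ)).congr_deriv ?_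
    ring
  have ibp := integral_mul_fderiv_eq_neg_fderiv_mul_of_integrable (μ := (volume : Measure (ℝ × ℝ)))
    (f := f) (g := φ) (v := ((1, 0) : ℝ × ℝ)) (by
      simp only [e3]
      refine Continuous.integrable_of_hasCompactSupport (by fun_prop) ?_
      exact hφ.2.mul_left)
    (by
      refine Continuous.integrable_of_hasCompactSupport (by fun_prop) ?_
      refine HasCompactSupport.mul_left ?_
      exact hφ.2.fderiv_apply ℝ _)
    (by
      refine Continuous.integrable_of_hasCompactSupport (by fun_prop) ?_
      exact hφ.2.mul_left)
    (fun x _ => fd x) (fun x _ => hd x)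
  calc _ = ∫ p : ℝ × ℝ, ((f p * fderiv ℝ φ p (1, 0) : ℝ) : ℂ) := by
        congr 1; ext p
        rw [e1, e2, pdxR_eq (hd p), Complex.ofReal_mul]
        simp [hf]
    _ = ((- ∫ p : ℝ × ℝ, fderiv ℝ f p (1, 0) * φ p : ℝ) : ℂ) := by
        rw [integral_complex_ofReal, ibp]
    _ = ((κ ^ 2 * ∫ p : ℝ × ℝ, Real.cos (κ * (p.1 - a)) * φ p : ℝ) : ℂ) := by
        rw [← integral_neg, ← integral_const_mul]
        congr 2; ext p; rw [e3]; ring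
    _ = _ := by
        rw [Complex.ofReal_mul, ← integral_complex_ofReal]
        push_cast; rfl

lemma mean_id {κ h : ℝ} {u : ℝ × ℝ → ℂ} (hu : LS κ h u) {p : ℝ × ℝ} (hp : h + 1 < |p.1|)
    {δ : ℝ} (hδ0 : 0 ≤ δ) (hδ1 : δ ≤ 1) (hδ : κ ^ 2 * δ ^ 2 ≤ 1 / 2)
    {η : ℝ → ℝ} (hη : Prof η) :
    AA u p η δ = u p * ((∫ q : ℝ × ℝ, Real.cos (κ * δ * q.1) * η (NN q) : ℝ) : ℂ) := by
  have hv := LS_cos κ h p.1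
  have h0 := AA_zero (LS_sub hu hv (u p)) hp (by simp) hδ0 hδ1 hδ hη
  have c1 := hu.1.continuous
  have c4 := hη.1.continuous
  have c5 := NN_cont
  have i1 : Integrable fun q : ℝ × ℝ => u (p + δ • q) * (η (NN q) : ℂ) :=
    int_of_Bx (by fun_prop) (fun q hq => by simp [hη.zero hq])
  have i2 : Integrable fun q : ℝ × ℝ => u p * ((Real.cos (κ * δ * q.1) * η (NN q) : ℝ) : ℂ) :=
    int_of_Bx (by fun_prop) (fun q hq => by simp [hη.zero hq])
  rw [← integral_complex_ofReal, ← integral_const_mul, ← sub_eq_zero]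
  unfold AA at h0 ⊢
  erw [← integral_sub i1 i2]
  rw [← h0]
  congr 1; ext q
  have : κ * ((p + δ • q).1 - p.1) = κ * δ * q.1 := by simp; ring
  beta_reduce
  rw [this]
  push_cast
  ring

lemma pdx_mean_id {κ h : ℝ} {u : ℝ × ℝ → ℂ} (hu : LS κ h u) {p : ℝ × ℝ} (hp : h + 1 < |p.1|)
    {δ : ℝ} (hδ0 : 0 < δ) (hδ1 : δ ≤ 1) (hδ : κ ^ 2 * δ ^ 2 ≤ 1 / 2)
    {η : ℝ → ℝ} (hη : Prof η) :
    pdx u p * ((∫ q : ℝ × ℝ, Real.cos (κ * δ * q.1) * η (NN q) : ℝ) : ℂ) =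
      -(δ⁻¹ : ℂ) * ∫ q : ℝ × ℝ, u (p + δ • q) * ((deriv η (NN q) * (2 * q.1) : ℝ) : ℂ) := by
  set c : ℂ := ((∫ q : ℝ × ℝ, Real.cos (κ * δ * q.1) * η (NN q) : ℝ) : ℂ)
  have c1 := hu.1.continuous
  have c2 := pdx_cont hu.1
  have c4 := hη.1.continuous
  have c5 := NN_cont
  have c6 : Continuous (deriv η) := hη.1.continuous_deriv (by simp)
  have hηd : ∀ s, HasDerivAt η (deriv η s) s :=
    fun s => (hη.1.differentiable (by simp) s).hasDerivAt
  have h1 : HasDerivAt (fun x : ℝ => AA u (x, p.2) η δ)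
      (∫ q : ℝ × ℝ, pdx u ((p.1, p.2) + δ • q) * (η (NN q) : ℂ)) p.1 := by
    refine deriv_under (F := fun x q => u ((x, p.2) + δ • q) * (η (NN q) : ℂ))
      (F' := fun x q => pdx u ((x, p.2) + δ • q) * (η (NN q) : ℂ)) ?_ ?_ ?_ ?_ ?_ p.1
    · intro t; fun_prop
    · fun_prop
    · intro t q hq; simp [hη.zero hq]
    · intro t q hq; simp [hη.zero hq]
    · intro t q
      refine HasDerivAt.mul_const ?_ _
      have hg : HasDerivAt (fun x : ℝ => ((x, p.2) : ℝ × ℝ) + δ • q) (1, 0) t :=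
        ((hasDerivAt_id t).prodMk (hasDerivAt_const t p.2)).add_const (δ • q)
      have := chain_curve hu.1 hg
      simpa using this
  have h2 : HasDerivAt (fun x : ℝ => AA u (x, p.2) η δ) (pdx u p * c) p.1 := by
    have hg : HasDerivAt (fun x : ℝ => ((x, p.2) : ℝ × ℝ)) (1, 0) p.1 :=
        ((hasDerivAt_id p.1).prodMk (hasDerivAt_const p.1 p.2))
    have h3 : HasDerivAt (fun x : ℝ => u (x, p.2)) (pdx u p) p.1 := by
      simpa using chain_curve hu.1 hg
    refine (h3.mul_const c).congr_of_eventuallyEq ?_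
    have : ∀ᶠ x : ℝ in nhds p.1, h + 1 < |x| :=
      (continuous_abs.tendsto p.1).eventually (lt_mem_nhds hp)
    filter_upwards [this] with x hx
    exact mean_id hu hx hδ0.le hδ1 hδ hη
  rw [h2.unique h1]
  set f : ℝ × ℝ → ℂ := fun q => u (p + δ • q) with hf
  set g : ℝ × ℝ → ℂ := fun q => (η (NN q) : ℂ) with hg
  have hfC : ContDiff ℝ 1 f := hu.1.comp (by fun_prop)
  have hgC : ContDiff ℝ 1 g := by
    have : ContDiff ℝ 1 (fun q => η (NN q)) :=
      (hη.1.of_le (by exact_mod_cast le_top)).comp (NN_contDiff.of_le (by exact_mod_cast le_top))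
    exact Complex.ofRealCLM.contDiff.comp this
  have df := fun q => hfC.differentiable one_ne_zero q
  have dg := fun q => hgC.differentiable one_ne_zero q
  have ef : ∀ q, fderiv ℝ f q (1, 0) = δ * pdx u (p + δ • q) := by
    intro q
    rw [← pdx_eq (df q)]
    refine HasDerivAt.deriv ?_
    have hk : HasDerivAt (fun x : ℝ => p + δ • ((x, q.2) : ℝ × ℝ)) (δ, 0) q.1 := by
      have := (((hasDerivAt_id q.1).prodMk (hasDerivAt_const q.1 q.2)).const_smul δ).const_add p
      simpa using this
    have := chain_curve hu.1 hk
    refine this.congr_deriv ?_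
    simp [mul_comm]
  have eg : ∀ q, fderiv ℝ g q (1, 0) = ((deriv η (NN q) * (2 * q.1) : ℝ) : ℂ) := by
    intro q
    rw [← pdx_eq (dg q)]
    refine HasDerivAt.deriv ?_
    have hk : HasDerivAt (fun x : ℝ => NN (x, q.2)) (2 * q.1) q.1 := by
      simp only [NN]
      simpa using ((hasDerivAt_id q.1).pow 2).add_const (q.2 ^ 2)
    exact (HasDerivAt.comp q.1 (h := fun x : ℝ => NN (x, q.2)) (hηd (NN q)) hk).ofReal_comp
  have hg0 : HasCompactSupport g := cs_of_Bx fun q hq => by simp [hg, hη.zero hq]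
  have cf := hfC.continuous
  have cg := hgC.continuous
  have cf' := hfC.continuous_fderiv one_ne_zero
  have cg' := hgC.continuous_fderiv one_ne_zero
  have ibp := integral_mul_fderiv_eq_neg_fderiv_mul_of_integrable (μ := (volume : Measure (ℝ × ℝ)))
    (f := f) (g := g) (v := ((1, 0) : ℝ × ℝ))
    (by
      refine Continuous.integrable_of_hasCompactSupport (by fun_prop) ?_
      exact hg0.mul_left)
    (by
      refine Continuous.integrable_of_hasCompactSupport (by fun_prop) ?_
      exact (hg0.fderiv_apply ℝ _).mul_left)
    (by
      refine Continuous.integrable_of_hasCompactSupport (by fun_prop) ?_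
      exact hg0.mul_left)
    (fun x _ => df x) (fun x _ => dg x)
  simp only [ef, eg] at ibp
  rw [ibp]
  have hδ' : (δ : ℂ) ≠ 0 := by exact_mod_cast hδ0.ne'
  simp only [mul_assoc]
  rw [integral_const_mul]
  field_simp
  simp [hg]

lemma growth {s : ℝ} (hs : s < -1) {u : ℝ × ℝ → ℂ} (hu : Continuous u) (hL : MemL2s s u)
    {δ : ℝ} (hδ0 : 0 < δ) (hδ1 : δ ≤ 1) {ψ : ℝ × ℝ → ℂ} (hψ : Continuous ψ)
    (hψ0 : ∀ q, q ∉ Bx → ψ q = 0) :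
    ∃ C : ℝ, 0 ≤ C ∧ ∀ p : ℝ × ℝ, ‖∫ q, u (p + δ • q) * ψ q‖
      ≤ C * (1 + (1 + p.1 ^ 2 + p.2 ^ 2) ^ (-s)) := by
  obtain ⟨P, hP⟩ := Bx_compact.exists_bound_of_continuousOn hψ.continuousOn
  have hP0 : 0 ≤ P := (norm_nonneg _).trans (hP (0, 0) (mem_Bx_of_NN (by simp [NN])))
  set g : ℝ × ℝ → ℝ := fun y => (1 + y.1 ^ 2 + y.2 ^ 2) ^ s * ‖u y‖ ^ 2 with hg
  have hw : Continuous fun y : ℝ × ℝ => (1 + y.1 ^ 2 + y.2 ^ 2) ^ s := by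
    refine Continuous.rpow_const (by fun_prop) fun y => Or.inl ?_
    positivity
  have hgc : Continuous g := by simp only [hg]; fun_prop
  have hg0 : ∀ y, 0 ≤ g y := fun y => by simp only [hg]; positivity
  have hgi : Integrable g := by
    refine ⟨hgc.aestronglyMeasurable, ?_⟩
    rw [hasFiniteIntegral_iff_ofReal (Eventually.of_forall hg0)]
    unfold MemL2s at hL
    convert hL using 3 with y
    simp only [hg]
    rw [ENNReal.ofReal_mul (by positivity), ENNReal.ofReal_pow (norm_nonneg _), ofReal_norm]
    rfl
  set e : ℝ := |(δ ^ Module.finrank ℝ (ℝ × ℝ))⁻¹|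
  have hch : ∀ p, ∫ q, g (p + δ • q) = e * ∫ y, g y := by
    intro p
    rw [Measure.integral_comp_smul volume (fun q => g (p + q)) δ, integral_add_left_eq_self]
    simp [e]
  have hci : ∀ p, Integrable fun q => g (p + δ • q) := by
    intro p
    exact (hgi.comp_add_left p).comp_smul hδ0.ne'
  set V := (volume : Measure (ℝ × ℝ)).real Bx
  set G := ∫ y, g y
  have hG : 0 ≤ G := integral_nonneg hg0
  have hV : 0 ≤ V := measureReal_nonneg
  have he : 0 ≤ e := abs_nonneg _
  refine ⟨P * (V + 5 ^ (-s) * (e * G)), by positivity, fun p => ?_⟩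
  set W := (1 + p.1 ^ 2 + p.2 ^ 2) with hW
  have hW0 : 0 < W := by positivity
  have i1 : Integrable (Bx.indicator fun _ => (1 : ℝ)) := by
    rw [integrable_indicator_iff Bx_compact.measurableSet]
    exact integrableOn_const Bx_compact.measure_lt_top.ne
  have key : ∀ q, ‖u (p + δ • q) * ψ q‖ ≤
      P * (Bx.indicator (fun _ => (1 : ℝ)) q + (5 * W) ^ (-s) * g (p + δ • q)) := by
    intro q
    by_cases hq : q ∈ Bx
    · rw [indicator_of_mem hq, norm_mul, mul_comm]
      have : ‖u (p + δ • q)‖ ≤ 1 + (5 * W) ^ (-s) * g (p + δ • q) := by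
        have h1 : ‖u (p + δ • q)‖ ≤ 1 + ‖u (p + δ • q)‖ ^ 2 := by
          nlinarith [sq_nonneg (‖u (p + δ • q)‖ - 1), sq_nonneg (‖u (p + δ • q)‖)]
        refine h1.trans ?_
        have h2 : 1 + (p + δ • q).1 ^ 2 + (p + δ • q).2 ^ 2 ≤ 5 * W := by
          have a1 : ∀ a b : ℝ, b ∈ Icc (-1) 1 → (a + δ * b) ^ 2 ≤ 2 * a ^ 2 + 2 := by
            intro a b hb
            have hb2 : b ^ 2 ≤ 1 := by nlinarith [hb.1, hb.2]
            have hd2 : δ ^ 2 ≤ 1 := by nlinarith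
            have : (δ * b) ^ 2 ≤ 1 := by
              rw [mul_pow]; nlinarith [sq_nonneg b, sq_nonneg δ]
            nlinarith [sq_nonneg (a - δ * b)]
          have b1 := a1 p.1 q.1 hq.1
          have b2 := a1 p.2 q.2 hq.2
          simp only [Prod.fst_add, Prod.snd_add, Prod.smul_fst, Prod.smul_snd, smul_eq_mul, hW]
          nlinarith [sq_nonneg p.1, sq_nonneg p.2]
        have h3 : (5 * W) ^ s ≤ (1 + (p + δ • q).1 ^ 2 + (p + δ • q).2 ^ 2) ^ s :=
          Real.rpow_le_rpow_of_nonpos (by positivity) h2 (by linarith)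
        have h4 : (5 * W) ^ (-s) * (5 * W) ^ s = 1 := by
          rw [← Real.rpow_add (by positivity)]; simp
        have h5 : 1 ≤ (5 * W) ^ (-s) * (1 + (p + δ • q).1 ^ 2 + (p + δ • q).2 ^ 2) ^ s := by
          exact h4.symm.le.trans (mul_le_mul_of_nonneg_left h3 (by positivity))
        have h6 := mul_le_mul_of_nonneg_right h5 (sq_nonneg ‖u (p + δ • q)‖)
        simp only [hg]
        linarith
      exact mul_le_mul (hP q hq) this (norm_nonneg _) hP0
    · rw [hψ0 q hq, mul_zero, norm_zero]
      have := hg0 (p + δ • q)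
      rw [indicator_of_notMem hq]
      positivity
  refine (norm_integral_le_of_norm_le ((i1.add ((hci p).const_mul _)).const_mul P)
    (Eventually.of_forall key)).trans ?_
  have e1 : ∫ q, P * (Bx.indicator (fun _ => (1 : ℝ)) q + (5 * W) ^ (-s) * g (p + δ • q))
      = P * (V + (5 * W) ^ (-s) * (e * G)) := by
    rw [integral_const_mul, integral_add i1 ((hci p).const_mul _), integral_const_mul, hch,
      integral_indicator Bx_compact.measurableSet]
    simp [V]
  erw [e1]
  rw [Real.mul_rpow (by norm_num) hW0.le]
  have h7 : 0 ≤ W ^ (-s) := by positivity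
  have h8 : (0:ℝ) ≤ 5 ^ (-s) * (e * G) := by positivity
  rw [mul_assoc P]
  refine mul_le_mul_of_nonneg_left ?_ hP0
  nlinarith [mul_nonneg hV h7]

lemma decay {s a C z : ℝ} (hs : s < -1) (ha : 0 < a) {f : ℝ → ℂ} {R : ℝ}
    (hf : ∀ x, R < |x| → ‖f x‖ ≤ C * (1 + (1 + x ^ 2 + z ^ 2) ^ (-s))) :
    Tendsto (fun x : ℝ => f x * ((Real.exp (-|x| * a) : ℝ) : ℂ)) (cocompact ℝ) (nhds 0) := by
  have habs : Tendsto (fun x : ℝ => |x|) (cocompact ℝ) atTop := tendsto_norm_cocompact_atTop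
  set ε := a / (2 * -s) with hε
  have hs' : 0 < -s := by linarith
  have hε0 : 0 < ε := by positivity
  set D := 1 + z ^ 2 + 2 / ε ^ 2 with hD
  have hD0 : 0 < D := by positivity
  have hb : ∀ x : ℝ, (1 + x ^ 2 + z ^ 2) ^ (-s) ≤ D ^ (-s) * Real.exp (|x| * (a / 2)) := by
    intro x
    have h1 := Real.quadratic_le_exp_of_nonneg (x := ε * |x|) (by positivity)
    have h0 : 0 ≤ ε * |x| := by positivity
    have h2 : 1 + x ^ 2 + z ^ 2 ≤ D * Real.exp (ε * |x|) := by
      have h3 : x ^ 2 ≤ 2 / ε ^ 2 * Real.exp (ε * |x|) := by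
        have : (ε * |x|) ^ 2 / 2 ≤ Real.exp (ε * |x|) := by linarith
        rw [mul_pow, sq_abs] at this
        rw [div_mul_eq_mul_div, le_div_iff₀ (by positivity)]
        linarith
      have h4 : 1 ≤ Real.exp (ε * |x|) := Real.one_le_exp h0
      have h5 : 1 + z ^ 2 ≤ (1 + z ^ 2) * Real.exp (ε * |x|) :=
        le_mul_of_one_le_right (by positivity) h4
      simp only [hD]
      linarith
    refine (Real.rpow_le_rpow (by positivity) h2 hs'.le).trans ?_
    rw [Real.mul_rpow hD0.le (Real.exp_pos _).le, ← Real.exp_mul]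
    apply le_of_eq
    congr 2
    have hs2 : s ≠ 0 := by linarith
    simp only [hε]
    field_simp
  have hT : Tendsto (fun x : ℝ => |C| * ((1 + D ^ (-s)) * Real.exp (-(|x| * (a / 2)))))
      (cocompact ℝ) (nhds (|C| * ((1 + D ^ (-s)) * 0))) := by
    refine Tendsto.const_mul _ (Tendsto.const_mul _ ?_)
    exact Real.tendsto_exp_neg_atTop_nhds_zero.comp (habs.atTop_mul_const (by positivity))
  rw [mul_zero, mul_zero] at hT
  refine squeeze_zero_norm' ?_ hT
  filter_upwards [habs.eventually_gt_atTop R] with x hx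
  rw [norm_mul, Complex.norm_real, Real.norm_eq_abs, abs_of_pos (Real.exp_pos _)]
  have h1 := hf x hx
  have h2 := hb x
  have h3 : (0:ℝ) ≤ (1 + x ^ 2 + z ^ 2) ^ (-s) := by positivity
  have h4 : ‖f x‖ ≤ |C| * ((1 + D ^ (-s)) * Real.exp (|x| * (a / 2))) := by
    refine h1.trans ((mul_le_mul_of_nonneg_right (le_abs_self C) (by positivity)).trans ?_)
    refine mul_le_mul_of_nonneg_left ?_ (abs_nonneg C)
    have : 1 ≤ Real.exp (|x| * (a / 2)) := Real.one_le_exp (by positivity)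
    linarith
  refine (mul_le_mul_of_nonneg_right h4 (Real.exp_pos _).le).trans (le_of_eq ?_)
  have : Real.exp (-(|x| * (a / 2))) = Real.exp (|x| * (a / 2)) * Real.exp (-|x| * a) := by
    rw [← Real.exp_add]; congr 1; ring
  rw [this]; ring

lemma exists_delta (κ : ℝ) : ∃ δ : ℝ, 0 < δ ∧ δ ≤ 1 ∧ κ ^ 2 * δ ^ 2 ≤ 1 / 2 := by
  refine ⟨1 / (2 + κ ^ 2), by positivity, ?_, ?_⟩
  · rw [div_le_one (by positivity)]; nlinarith [sq_nonneg κ]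
  · rw [div_pow, one_pow, mul_one_div, div_le_iff₀ (by positivity)]
    nlinarith [sq_nonneg κ, sq_nonneg (κ ^ 2)]

/-- **Lemma (exponential growth bound).**  If `u ∈ L^{2,s}(ℝ²)`, `s < -1`, is a weak
solution of `Δu + k² n(x)² u = 0`, then for every `z` and every `γ_* ∈ (0, d²)`,
`u(x,z) e^{-|x|√(d²-γ_*)} → 0` and `u_x(x,z) e^{-|x|√(d²-γ_*)} → 0` as `|x| → ∞`. -/
theorem weak_solution_exponential_growth_bound
    (h k ncl nstar : ℝ) (hh : 0 < h) (hk : 0 < k) (hncl : 0 < ncl)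
    (n : ℝ → ℝ) (hn_meas : Measurable n) (hn_bdd : ∃ C, ∀ x, |n x| ≤ C)
    (hn_cl : ∀ x, h < |x| → n x = ncl)
    (hn_star : nstar = sSup (Set.range n)) (hstar_gt : ncl < nstar)
    (s : ℝ) (hs : s < -1)
    (u : ℝ × ℝ → ℂ) (hsol : IsWeakSol0 k n u) (hL : MemL2s s u)
    (γstar : ℝ) (hγ : γstar ∈ Set.Ioo 0 (k ^ 2 * (nstar ^ 2 - ncl ^ 2))) :
    ∀ z : ℝ,
      Tendsto (fun x : ℝ =>
          u (x, z) *
            ((Real.exp (-|x| * Real.sqrt (k ^ 2 * (nstar ^ 2 - ncl ^ 2) - γstar)) : ℝ) : ℂ))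
        (cocompact ℝ) (nhds 0) ∧
      Tendsto (fun x : ℝ =>
          pdx u (x, z) *
            ((Real.exp (-|x| * Real.sqrt (k ^ 2 * (nstar ^ 2 - ncl ^ 2) - γstar)) : ℝ) : ℂ))
        (cocompact ℝ) (nhds 0) := by
  set κ := k * ncl with hκ
  have hu : LS κ h u := LS_of_sol hn_cl hsol
  obtain ⟨δ, hδ0, hδ1, hδ⟩ := exists_delta κ
  set η : ℝ → ℝ := fun s => Real.smoothTransition (1 - s) with hηd
  have hη : Prof η := by
    refine ⟨?_, fun s hs => Real.smoothTransition.zero_of_nonpos (by linarith)⟩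
    exact Real.smoothTransition.contDiff.comp (by fun_prop)
  have c1 := hu.1.continuous
  have c4 := hη.1.continuous
  have c5 := NN_cont
  have c6 : Continuous (deriv η) := hη.1.continuous_deriv (by simp)
  set c : ℝ := ∫ q : ℝ × ℝ, Real.cos (κ * δ * q.1) * η (NN q) with hc
  have hcpos : 0 < c := by
    refine Continuous.integral_pos_of_hasCompactSupport_nonneg_nonzero (x := (0, 0)) (by fun_prop)
      (cs_of_Bx fun q hq => by simp [hη.zero hq]) ?_ ?_
    · intro q
      show 0 ≤ Real.cos (κ * δ * q.1) * η (NN q)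
      by_cases hq : q ∈ Bx
      · refine mul_nonneg (Real.cos_nonneg_of_mem_Icc ?_) (Real.smoothTransition.nonneg _)
        have h1 : |κ * δ * q.1| ≤ 1 := by
          rw [← sq_le_one_iff_abs_le_one]
          have hb2 : q.1 ^ 2 ≤ 1 := by nlinarith [hq.1.1, hq.1.2]
          rw [mul_pow, mul_pow]
          nlinarith [sq_nonneg q.1, mul_nonneg (sq_nonneg κ) (sq_nonneg δ)]
        have h2 := abs_le.1 h1
        have := Real.pi_gt_three
        constructor <;> linarith [h2.1, h2.2]
      · simp [hη.zero hq]
    · simp [NN, hηd]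
  have hcn : ‖(c : ℂ)‖ = c := by rw [Complex.norm_real, Real.norm_eq_abs, abs_of_pos hcpos]
  have ha : 0 < Real.sqrt (k ^ 2 * (nstar ^ 2 - ncl ^ 2) - γstar) :=
    Real.sqrt_pos.2 (by linarith [hγ.2])
  obtain ⟨C1, hC1, hb1⟩ := growth hs c1 hL hδ0 hδ1 (ψ := fun q => (η (NN q) : ℂ)) (by fun_prop)
    (fun q hq => by simp [hη.zero hq])
  have hη' : ∀ s, 1 < s → deriv η s = 0 := by
    intro s hs
    have : η =ᶠ[nhds s] fun _ => 0 := by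
      filter_upwards [lt_mem_nhds hs] with x hx
      exact hη.2 x hx.le
    rw [this.deriv_eq]; simp
  obtain ⟨C2, hC2, hb2⟩ := growth hs c1 hL hδ0 hδ1
    (ψ := fun q => ((deriv η (NN q) * (2 * q.1) : ℝ) : ℂ)) (by fun_prop)
    (fun q hq => by
      have : 1 < NN q := by
        by_contra hcon
        exact hq (mem_Bx_of_NN (not_lt.1 hcon))
      simp [hη' _ this])
  intro z
  constructor
  · refine decay (C := C1 / c) (R := h + 1) (z := z) hs ha fun x hx => ?_
    have h1 := mean_id hu (p := (x, z)) hx hδ0.le hδ1 hδ hη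
    have h2 := hb1 (x, z)
    have h3 : ‖u (x, z)‖ * c ≤ C1 * (1 + (1 + x ^ 2 + z ^ 2) ^ (-s)) := by
      rw [← hcn, ← norm_mul, ← h1]
      exact h2
    rw [div_mul_eq_mul_div, le_div_iff₀ hcpos]
    exact h3
  · refine decay (C := δ⁻¹ * C2 / c) (R := h + 1) (z := z) hs ha fun x hx => ?_
    have h1 := pdx_mean_id hu (p := (x, z)) hx hδ0 hδ1 hδ hη
    have h2 := hb2 (x, z)
    have h3 : ‖pdx u (x, z)‖ * c ≤ δ⁻¹ * (C2 * (1 + (1 + x ^ 2 + z ^ 2) ^ (-s))) := by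
      rw [← hcn, ← norm_mul, h1, norm_mul, norm_neg, norm_inv, Complex.norm_real,
        Real.norm_eq_abs, abs_of_pos hδ0]
      exact mul_le_mul_of_nonneg_left h2 (by positivity)
    rw [div_mul_eq_mul_div, le_div_iff₀ hcpos, mul_assoc]
    exact h3
end
end

section
/- Let q : ℝ → ℝ be bounded and measurable, let γ, λ ∈ ℝ with γ ≠ λ, and let e, v : ℝ → ℝ be twice continuously differentiable functions with e''(x) + (γ − q(x)) e(x) = 0 and v''(x) + (λ − q(x)) v(x) = 0 on ℝ. Assume there exist constants C, μ > 0 with |e(x)| + |e'(x)| ≤ C e^{−μ|x|} for all x ∈ ℝ, and that v and v' are bounded on ℝ. Then ∫_{−∞}^{+∞} e(x) v(x) dx = 0. -/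
open MeasureTheory Set
open scoped ENNReal NNReal

noncomputable section

/-- **Orthogonality lemma.**  Let `q` be bounded and measurable, `γ ≠ λ`, and let `e, v`
be twice continuously differentiable real solutions of `e'' + (γ - q)e = 0` and
`v'' + (λ - q)v = 0` on `ℝ`.  If `e` and `e'` decay exponentially and `v, v'` are bounded,
then `∫ e v = 0`. -/
theorem guided_radiation_orthogonality
    (q : ℝ → ℝ) (hq_meas : Measurable q) (hq_bdd : ∃ C, ∀ x, |q x| ≤ C)
    (γ lam : ℝ) (hne : γ ≠ lam)
    (e v : ℝ → ℝ) (he_C2 : ContDiff ℝ 2 e) (hv_C2 : ContDiff ℝ 2 v)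
    (he_ode : ∀ x : ℝ, deriv (deriv e) x + (γ - q x) * e x = 0)
    (hv_ode : ∀ x : ℝ, deriv (deriv v) x + (lam - q x) * v x = 0)
    (hdecay : ∃ C > 0, ∃ μ > 0, ∀ x : ℝ,
      |e x| + |deriv e x| ≤ C * Real.exp (-μ * |x|))
    (hv_bdd : ∃ C, ∀ x : ℝ, |v x| ≤ C) (hv'_bdd : ∃ C, ∀ x : ℝ, |deriv v x| ≤ C) :
    ∫ x : ℝ, e x * v x = 0 := by
  obtain ⟨C, hC, μ, hμ, hdec⟩ := hdecay
  obtain ⟨A, hA⟩ := hv_bdd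
  obtain ⟨B, hB⟩ := hv'_bdd
  -- if the integrand were not integrable, the Bochner integral would be zero by convention
  by_cases hint : Integrable (fun x : ℝ => e x * v x)
  swap
  · exact integral_undef hint
  have he1 : ∀ x, HasDerivAt e (deriv e x) x := fun x =>
    ((he_C2.differentiable (by norm_num)) x).hasDerivAt
  have hv1 : ∀ x, HasDerivAt v (deriv v x) x := fun x =>
    ((hv_C2.differentiable (by norm_num)) x).hasDerivAt
  have he2 : ∀ x, HasDerivAt (deriv e) (deriv (deriv e) x) x := fun x =>
    (((contDiff_succ_iff_deriv (n := 1)).1 he_C2).2.2.differentiable (by norm_num) x).hasDerivAt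
  have hv2 : ∀ x, HasDerivAt (deriv v) (deriv (deriv v) x) x := fun x =>
    (((contDiff_succ_iff_deriv (n := 1)).1 hv_C2).2.2.differentiable (by norm_num) x).hasDerivAt
  have hW : ∀ x, HasDerivAt (fun x => e x * deriv v x - deriv e x * v x)
      ((γ - lam) * (e x * v x)) x := by
    intro x
    refine (((he1 x).mul (hv2 x)).sub ((he2 x).mul (hv1 x))).congr_deriv ?_
    linear_combination e x * hv_ode x - v x * he_ode x
  have hbound : ∀ x, ‖e x * deriv v x - deriv e x * v x‖
      ≤ (C * (A + B)) * Real.exp (-μ * |x|) := by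
    intro x
    have h1 : |e x * deriv v x| ≤ |e x| * B := by
      rw [abs_mul]; exact mul_le_mul_of_nonneg_left (hB x) (abs_nonneg _)
    have h2 : |deriv e x * v x| ≤ |deriv e x| * A := by
      rw [abs_mul]; exact mul_le_mul_of_nonneg_left (hA x) (abs_nonneg _)
    have hA0 : 0 ≤ A := (abs_nonneg _).trans (hA x)
    have hB0 : 0 ≤ B := (abs_nonneg _).trans (hB x)
    have h3 := abs_sub (e x * deriv v x) (deriv e x * v x)
    have h4 := mul_le_mul_of_nonneg_right (hdec x) (add_nonneg hA0 hB0)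
    have h5 := mul_nonneg (abs_nonneg (e x)) hA0
    have h6 := mul_nonneg (abs_nonneg (deriv e x)) hB0
    rw [Real.norm_eq_abs]
    nlinarith
  have hlim : ∀ l : Filter ℝ, Filter.Tendsto (fun x : ℝ => |x|) l Filter.atTop →
      Filter.Tendsto (fun x => e x * deriv v x - deriv e x * v x) l (nhds 0) := by
    intro l hl
    refine squeeze_zero_norm hbound ?_
    have := (Real.tendsto_exp_atBot.comp
      (hl.const_mul_atTop_of_neg (neg_lt_zero.2 hμ))).const_mul (C * (A + B))
    simpa using this
  have key := integral_of_hasDerivAt_of_tendsto hW (hint.const_mul _)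
    (hlim _ Filter.tendsto_abs_atBot_atTop) (hlim _ Filter.tendsto_abs_atTop_atTop)
  rw [integral_const_mul, sub_zero] at key
  exact (mul_eq_zero.1 key).resolve_left (sub_ne_zero.2 hne)
end
end

section
/- Let T > 0, h > 0, d > 0, and let q : [−h, h] → ℝ be of bounded variation with 0 ≤ q(x) ≤ d²; set p(x) = d² − q(x). For τ ∈ ℂ \ {0} set λ = d² + τ², and let φ_s(·, λ) : [−h, h] → ℂ be the solution of φ'' + (λ − q(x)) φ = 0 with φ_s(0, λ) = 1, φ_s'(0, λ) = 0. Define Φ_s(x, τ) = φ_s(x, λ) + φ_s'(x, λ)/(iτ). Then there exist constants C > 0 and R₀ > 0 such that for all τ with |Im τ| ≤ T and |τ| ≥ R₀, and all x ∈ [−h, h], one has | Φ_s(x, τ) − [ 1 + (i/(2τ)) ∫₀^x p(y) dy ] e^{iτx} | ≤ C / |τ|². -/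
open MeasureTheory Set Complex
open scoped ENNReal NNReal

noncomputable section

lemma ii_ofReal {f : ℝ → ℝ} {a b : ℝ} (hf : IntervalIntegrable f volume a b) :
    IntervalIntegrable (fun y => (f y : ℂ)) volume a b :=
  ⟨Integrable.ofReal hf.1, Integrable.ofReal hf.2⟩

lemma osc_aux (h : ℝ) (f : ℝ → ℝ) (hf : MonotoneOn f (Icc (-h) h)) (c : ℂ) (hc : c ≠ 0)
    (K : ℝ) (hK : ∀ y ∈ Icc (-h) h, ‖Complex.exp (c * (y : ℂ))‖ ≤ K) (a b : ℝ)
    (ha : a ∈ Icc (-h) h) (hb : b ∈ Icc (-h) h) (hab : a ≤ b) (δ : ℝ) (hδ : b - a ≤ δ) :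
    ‖(∫ y in a..b, (f y : ℂ) * Complex.exp (c * (y : ℂ)))
      - (f b * (Complex.exp (c * (b : ℂ)) / c) - f a * (Complex.exp (c * (a : ℂ)) / c))‖
      ≤ (f b - f a) * (K * δ + K / ‖c‖) := by
  have hsub : Icc a b ⊆ Icc (-h) h := Icc_subset_Icc ha.1 hb.2
  have hK0 : 0 ≤ K := (norm_nonneg _).trans (hK a ha)
  have hfab : f a ≤ f b := hf ha hb hab
  have hE : ∫ y in a..b, Complex.exp (c * (y : ℂ)) =
      Complex.exp (c * (b : ℂ)) / c - Complex.exp (c * (a : ℂ)) / c := by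
    rw [integral_exp_mul_complex hc]; ring
  have hfi : IntervalIntegrable f volume a b := by
    apply MonotoneOn.intervalIntegrable
    rw [uIcc_of_le hab]; exact hf.mono hsub
  have hfi' : IntervalIntegrable (fun y => (f y : ℂ)) volume a b := ii_ofReal hfi
  have hi : IntervalIntegrable (fun y : ℝ => (f y : ℂ) * Complex.exp (c * (y : ℂ))) volume a b :=
    hfi'.mul_continuousOn (by fun_prop)
  have hi2 : IntervalIntegrable (fun y : ℝ => (f a : ℂ) * Complex.exp (c * (y : ℂ))) volume a b :=
    Continuous.intervalIntegrable (by fun_prop) _ _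
  have e1 : (∫ y in a..b, (f y : ℂ) * Complex.exp (c * (y : ℂ)))
      - (f b * (Complex.exp (c * (b : ℂ)) / c) - f a * (Complex.exp (c * (a : ℂ)) / c))
      = (∫ y in a..b, ((f y : ℂ) * Complex.exp (c * (y : ℂ)) - f a * Complex.exp (c * (y : ℂ))))
        - ((f b - f a : ℝ) : ℂ) * (Complex.exp (c * (b : ℂ)) / c) := by
    rw [intervalIntegral.integral_sub hi hi2, intervalIntegral.integral_const_mul, hE]
    push_cast; ring
  rw [e1]
  have b1 : ‖∫ y in a..b, ((f y : ℂ) * Complex.exp (c * (y : ℂ)) - f a * Complex.exp (c * (y : ℂ)))‖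
      ≤ ((f b - f a) * K) * |b - a| := by
    apply intervalIntegral.norm_integral_le_of_norm_le_const
    intro y hy
    rw [uIoc_of_le hab] at hy
    have hy' : y ∈ Icc (-h) h := hsub ⟨hy.1.le, hy.2⟩
    rw [← sub_mul, norm_mul, ← Complex.ofReal_sub, Complex.norm_real, Real.norm_eq_abs,
      abs_of_nonneg (sub_nonneg.2 (hf ha hy' hy.1.le))]
    have := hf hy' hb hy.2
    exact mul_le_mul (by linarith) (hK y hy') (norm_nonneg _) (by linarith)
  have b2 : ‖((f b - f a : ℝ) : ℂ) * (Complex.exp (c * (b : ℂ)) / c)‖ ≤ (f b - f a) * (K / ‖c‖) := by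
    rw [norm_mul, norm_div, Complex.norm_real, Real.norm_eq_abs, abs_of_nonneg (sub_nonneg.2 hfab)]
    have := hK b hb
    have := sub_nonneg.2 hfab
    gcongr
  rw [abs_of_nonneg (sub_nonneg.2 hab)] at b1
  have b3 : ((f b - f a) * K) * (b - a) ≤ ((f b - f a) * K) * δ :=
    mul_le_mul_of_nonneg_left hδ (mul_nonneg (sub_nonneg.2 hfab) hK0)
  calc _ ≤ _ := norm_sub_le _ _
    _ ≤ _ := add_le_add (b1.trans b3) b2
    _ = _ := by ring

lemma osc_mono (h : ℝ) (f : ℝ → ℝ) (hf : MonotoneOn f (Icc (-h) h)) (c : ℂ) (hc : c ≠ 0)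
    (K : ℝ) (hK : ∀ y ∈ Icc (-h) h, ‖Complex.exp (c * (y : ℂ))‖ ≤ K) (a b : ℝ)
    (ha : a ∈ Icc (-h) h) (hb : b ∈ Icc (-h) h) (hab : a ≤ b) :
    ‖(∫ y in a..b, (f y : ℂ) * Complex.exp (c * (y : ℂ)))‖
      ≤ ((f h - f (-h)) * (K * (2 * h) + K) + 2 * (|f h| + |f (-h)|) * K) / ‖c‖ := by
  have hK0 : 0 ≤ K := (norm_nonneg _).trans (hK a ha)
  have hcn : 0 < ‖c‖ := norm_pos_iff.2 hc
  have hh : -h ≤ h := ha.1.trans ha.2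
  set n := ⌈‖c‖⌉₊ with hn
  have hn1 : ‖c‖ ≤ n := Nat.le_ceil _
  have hn0 : (0:ℝ) < n := hcn.trans_le hn1
  set u : ℕ → ℝ := fun k => a + k * ((b - a) / n) with hu
  have hu0 : u 0 = a := by simp [hu]
  have hun : u n = b := by simp only [hu]; field_simp; ring
  have hstep : ∀ k, u (k+1) - u k = (b - a) / n := by intro k; simp only [hu]; push_cast; ring
  have hpos : 0 ≤ (b - a) / n := div_nonneg (by linarith) hn0.le
  have humono : Monotone u := monotone_nat_of_le_succ (fun k => by linarith [hstep k])
  have hmem : ∀ k, k ≤ n → u k ∈ Icc (-h) h := fun k hk =>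
    ⟨ha.1.trans (hu0 ▸ humono (Nat.zero_le k)), (humono hk).trans (hun ▸ hb.2)⟩
  have hint : ∀ k < n, IntervalIntegrable (fun y : ℝ => (f y : ℂ) * Complex.exp (c * (y : ℂ)))
      volume (u k) (u (k+1)) := by
    intro k hk
    have : IntervalIntegrable f volume (u k) (u (k+1)) := by
      apply MonotoneOn.intervalIntegrable
      rw [uIcc_of_le (humono (Nat.le_succ k))]
      exact hf.mono (Icc_subset_Icc (hmem k hk.le).1 (hmem (k+1) hk).2)
    have h2 : IntervalIntegrable (fun y => (f y : ℂ)) volume (u k) (u (k+1)) := ii_ofReal this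
    exact h2.mul_continuousOn (by fun_prop)
  have hsum := intervalIntegral.sum_integral_adjacent_intervals hint
  rw [hu0, hun] at hsum
  set G : ℕ → ℂ := fun k => f (u k) * (Complex.exp (c * (u k : ℂ)) / c) with hG
  have hGs := Finset.sum_range_sub G n
  have hδ : ∀ k, u (k+1) - u k ≤ 2 * h / ‖c‖ := by
    intro k; rw [hstep]
    have : b - a ≤ 2 * h := by linarith [ha.1, hb.2]
    exact div_le_div₀ (by linarith) this hcn hn1
  have hk : ‖∑ k ∈ Finset.range n, ((∫ y in u k..u (k+1), (f y : ℂ) * Complex.exp (c * (y : ℂ)))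
      - (G (k+1) - G k))‖ ≤ ∑ k ∈ Finset.range n,
        (f (u (k+1)) - f (u k)) * (K * (2 * h / ‖c‖) + K / ‖c‖) := by
    apply norm_sum_le_of_le
    intro k hk
    rw [Finset.mem_range] at hk
    exact osc_aux h f hf c hc K hK _ _ (hmem k hk.le) (hmem (k+1) hk) (humono (Nat.le_succ k)) _ (hδ k)
  rw [Finset.sum_sub_distrib, hsum, hGs, ← Finset.sum_mul, Finset.sum_range_sub (fun k => f (u k)),
    hu0, hun] at hk
  have hl : (-h) ∈ Icc (-h) h := ⟨le_rfl, hh⟩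
  have hr : h ∈ Icc (-h) h := ⟨hh, le_rfl⟩
  have hfb : ∀ k ≤ n, |f (u k)| ≤ |f h| + |f (-h)| := by
    intro k hk
    have h1 := hf hl (hmem k hk) (hmem k hk).1
    have h2 := hf (hmem k hk) hr (hmem k hk).2
    rw [abs_le]
    constructor
    · linarith [neg_abs_le (f (-h)), abs_nonneg (f h)]
    · linarith [le_abs_self (f h), abs_nonneg (f (-h))]
  have hGb : ∀ k ≤ n, ‖G k‖ ≤ (|f h| + |f (-h)|) * (K / ‖c‖) := by
    intro k hk
    simp only [hG]
    rw [norm_mul, norm_div, Complex.norm_real, Real.norm_eq_abs]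
    have := hK _ (hmem k hk)
    have := hfb k hk
    gcongr
  have h3 : (f b - f a) * (K * (2 * h / ‖c‖) + K / ‖c‖) ≤
      (f h - f (-h)) * (K * (2 * h / ‖c‖) + K / ‖c‖) := by
    have h1 := hf hl ha ha.1
    have h2 := hf hb hr hb.2
    have : 0 ≤ h := by linarith
    apply mul_le_mul_of_nonneg_right (by linarith) (by positivity)
  have h4 := norm_le_norm_sub_add (∫ y in a..b, (f y : ℂ) * Complex.exp (c * (y : ℂ))) (G n - G 0)
  have h5 := norm_sub_le (G n) (G 0)
  have h6 := hGb n le_rfl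
  have h7 := hGb 0 (Nat.zero_le _)
  calc _ ≤ (f h - f (-h)) * (K * (2 * h / ‖c‖) + K / ‖c‖)
        + 2 * ((|f h| + |f (-h)|) * (K / ‖c‖)) := by linarith
    _ = _ := by ring

lemma osc_bv (h : ℝ) (hh : 0 < h) (K : ℝ) (p : ℝ → ℝ) (hp : BoundedVariationOn p (Icc (-h) h)) :
    (∀ a ∈ Icc (-h) h, ∀ b ∈ Icc (-h) h, IntervalIntegrable p volume a b) ∧
    ∃ C : ℝ, 0 ≤ C ∧ ∀ c : ℂ, c ≠ 0 → (∀ y ∈ Icc (-h) h, ‖Complex.exp (c * (y : ℂ))‖ ≤ K) →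
      ∀ a ∈ Icc (-h) h, ∀ b ∈ Icc (-h) h,
        ‖(∫ y in a..b, (p y : ℂ) * Complex.exp (c * (y : ℂ)))‖ ≤ C / ‖c‖ := by
  obtain ⟨f, g, hf, hg, hfg⟩ := hp.locallyBoundedVariationOn.exists_monotoneOn_sub_monotoneOn
  have hmi : ∀ f : ℝ → ℝ, MonotoneOn f (Icc (-h) h) → ∀ a ∈ Icc (-h) h, ∀ b ∈ Icc (-h) h,
      IntervalIntegrable f volume a b := by
    intro f hf a ha b hb
    apply MonotoneOn.intervalIntegrable
    exact hf.mono (ordConnected_Icc.uIcc_subset ha hb)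
  refine ⟨?_, ?_⟩
  · intro a ha b hb
    rw [hfg]
    exact (hmi f hf a ha b hb).sub (hmi g hg a ha b hb)
  · set D : (ℝ → ℝ) → ℝ := fun f =>
      ((f h - f (-h)) * (K * (2 * h) + K) + 2 * (|f h| + |f (-h)|) * K) with hD
    have main : ∀ c : ℂ, c ≠ 0 → (∀ y ∈ Icc (-h) h, ‖Complex.exp (c * (y : ℂ))‖ ≤ K) →
      ∀ a ∈ Icc (-h) h, ∀ b ∈ Icc (-h) h,
        ‖(∫ y in a..b, (p y : ℂ) * Complex.exp (c * (y : ℂ)))‖ ≤ (|D f| + |D g|) / ‖c‖ := by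
      intro c hc hK
      have key : ∀ a ∈ Icc (-h) h, ∀ b ∈ Icc (-h) h, a ≤ b →
          ‖(∫ y in a..b, (p y : ℂ) * Complex.exp (c * (y : ℂ)))‖ ≤ (|D f| + |D g|) / ‖c‖ := by
        intro a ha b hb hab
        have h1 := osc_mono h f hf c hc K hK a b ha hb hab
        have h2 := osc_mono h g hg c hc K hK a b ha hb hab
        have i1 : IntervalIntegrable (fun y : ℝ => (f y : ℂ) * Complex.exp (c * (y : ℂ))) volume a b :=
          IntervalIntegrable.mul_continuousOn (ii_ofReal (hmi f hf a ha b hb)) (by fun_prop)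
        have i2 : IntervalIntegrable (fun y : ℝ => (g y : ℂ) * Complex.exp (c * (y : ℂ))) volume a b :=
          IntervalIntegrable.mul_continuousOn (ii_ofReal (hmi g hg a ha b hb)) (by fun_prop)
        have e : (fun y : ℝ => (p y : ℂ) * Complex.exp (c * (y : ℂ))) = fun y : ℝ =>
            (f y : ℂ) * Complex.exp (c * (y : ℂ)) - (g y : ℂ) * Complex.exp (c * (y : ℂ)) := by
          funext y; rw [hfg]; simp [sub_mul]
        rw [e, intervalIntegral.integral_sub i1 i2]
        refine (norm_sub_le _ _).trans ((add_le_add h1 h2).trans ?_)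
        rw [← add_div]
        gcongr
        exacts [le_abs_self _, le_abs_self _]
      intro a ha b hb
      rcases le_total a b with hab | hab
      · exact key a ha b hb hab
      · rw [intervalIntegral.integral_symm, norm_neg]
        exact key b hb a ha hab
    exact ⟨|D f| + |D g|, by positivity, main⟩

/-- **Asymptotic estimate for `Φ_s`.**  Let `q` be of bounded variation on `[-h,h]` with
`0 ≤ q ≤ d²`, and for each `τ ≠ 0` let `φ τ` be the solution of
`φ'' + (d² + τ² - q(x)) φ = 0` on `[-h,h]` with `φ(0) = 1`, `φ'(0) = 0` (the derivative
being `φd τ`).  Then `Φ_s(x,τ) = φ(x) + φ'(x)/(iτ)` satisfies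
`Φ_s(x,τ) = [1 + (i/(2τ)) ∫₀ˣ (d² - q)] e^{iτx} + O(1/|τ|²)` uniformly for
`x ∈ [-h,h]` and `|Im τ| ≤ T`. -/
theorem Phi_s_asymptotics
    (T h d : ℝ) (hT : 0 < T) (hh : 0 < h) (hd : 0 < d)
    (q : ℝ → ℝ) (hq_bv : BoundedVariationOn q (Set.Icc (-h) h))
    (hq_bdd : ∀ x ∈ Set.Icc (-h) h, 0 ≤ q x ∧ q x ≤ d ^ 2)
    (φ φd : ℂ → ℝ → ℂ)
    (hφ : ∀ τ : ℂ, τ ≠ 0 → ∀ x ∈ Set.Icc (-h) h,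
      HasDerivWithinAt (φ τ) (φd τ x) (Set.Icc (-h) h) x)
    (hφd : ∀ τ : ℂ, τ ≠ 0 → ∀ x ∈ Set.Icc (-h) h,
      HasDerivWithinAt (φd τ)
        (-((((d : ℂ) ^ 2 + τ ^ 2) - ((q x : ℝ) : ℂ)) * φ τ x)) (Set.Icc (-h) h) x)
    (hinit : ∀ τ : ℂ, τ ≠ 0 → φ τ 0 = 1 ∧ φd τ 0 = 0) :
    ∃ C > 0, ∃ R₀ > 0, ∀ τ : ℂ, τ ≠ 0 → |τ.im| ≤ T → R₀ ≤ ‖τ‖ →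
      ∀ x ∈ Set.Icc (-h) h,
        ‖(φ τ x + φd τ x / (Complex.I * τ)) -
            (1 + Complex.I / (2 * τ) *
                ((∫ y in (0 : ℝ)..x, (d ^ 2 - q y) : ℝ) : ℂ)) *
              Complex.exp (Complex.I * τ * (x : ℂ))‖ ≤ C / ‖τ‖ ^ 2 := by
  have h0 : (0:ℝ) ∈ Icc (-h) h := ⟨by linarith, hh.le⟩
  set K : ℝ := Real.exp (2 * T * h) with hKdef
  have hK1 : 1 ≤ K := Real.one_le_exp (by positivity)
  have hKpos : 0 < K := by linarith
  set p : ℝ → ℝ := fun y => d ^ 2 - q y with hp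
  have hp_bv : BoundedVariationOn p (Icc (-h) h) := by
    obtain ⟨f, g, hf, hg, hfg⟩ := hq_bv.locallyBoundedVariationOn.exists_monotoneOn_sub_monotoneOn
    have e : eVariationOn p (Icc (-h) h) = eVariationOn q (Icc (-h) h) := by
      unfold eVariationOn
      simp only [hp, edist_sub_left]
    unfold BoundedVariationOn
    rw [e]; exact hq_bv
  have hp_bdd : ∀ x ∈ Icc (-h) h, |p x| ≤ d ^ 2 := by
    intro x hx
    have := hq_bdd x hx
    rw [abs_le]; simp only [hp]; constructor <;> nlinarith
  obtain ⟨hpi, C1, hC1, hosc⟩ := osc_bv h hh K p hp_bv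
  refine ⟨K * (2 * d ^ 4 * K ^ 2 * h ^ 2 + C1) + 1, by positivity, 2 * d ^ 2 * K * h, by positivity, ?_⟩
  intro τ hτ him hR x hx
  have hτn : 0 < ‖τ‖ := norm_pos_iff.2 hτ
  have hexp : ∀ s : ℂ, |s.re| ≤ 2 * T → ∀ y ∈ Icc (-h) h, ‖Complex.exp (s * (y : ℂ))‖ ≤ K := by
    intro s hs y hy
    rw [Complex.norm_exp, hKdef, Real.exp_le_exp]
    have : (s * (y : ℂ)).re = s.re * y := by simp
    rw [this]
    calc s.re * y ≤ |s.re * y| := le_abs_self _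
      _ = |s.re| * |y| := abs_mul _ _
      _ ≤ 2 * T * h := mul_le_mul hs (abs_le.2 hy) (abs_nonneg _) (by positivity)
  have hr1 : |(Complex.I * τ).re| ≤ 2 * T := by simp; linarith
  have hr2 : |(2 * Complex.I * τ).re| ≤ 2 * T := by
    simp [abs_mul]; linarith
  have hr3 : |(-2 * Complex.I * τ).re| ≤ 2 * T := by
    simp [abs_mul]; linarith
  have hd1 := hφ τ hτ
  have hd2 := hφd τ hτ
  obtain ⟨hi1, hi2⟩ := hinit τ hτ
  set A : ℝ → ℂ := fun y => (φ τ y + φd τ y / (Complex.I * τ)) * Complex.exp (-(Complex.I * τ) * y) with hA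
  set B : ℝ → ℂ := fun y => (φ τ y - φd τ y / (Complex.I * τ)) * Complex.exp ((Complex.I * τ) * y) with hB
  set A' : ℝ → ℂ := fun y => Complex.I / (2 * τ) * ((p y : ℂ) * (A y + B y * Complex.exp (-2 * Complex.I * τ * y))) with hA'
  set B' : ℝ → ℂ := fun y => -(Complex.I / (2 * τ)) * ((p y : ℂ) * (B y + A y * Complex.exp (2 * Complex.I * τ * y))) with hB'
  have hE : ∀ (s : ℂ) (y : ℝ), HasDerivWithinAt (fun y : ℝ => Complex.exp (s * (y : ℂ)))
      (Complex.exp (s * (y : ℂ)) * s) (Icc (-h) h) y := by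
    intro s y
    have h1 : HasDerivAt (fun y : ℝ => s * (y : ℂ)) (s * 1) y :=
      (Complex.ofRealCLM.hasDerivAt (x := y)).const_mul s
    rw [mul_one] at h1
    exact h1.cexp.hasDerivWithinAt
  have hI : Complex.I ≠ 0 := Complex.I_ne_zero
  have hcan : ∀ y : ℝ, Complex.exp (Complex.I * τ * y) * Complex.exp (-2 * Complex.I * τ * y) =
      Complex.exp (-(Complex.I * τ) * y) := by
    intro y; rw [← Complex.exp_add]; congr 1; ring
  have hcan2 : ∀ y : ℝ, Complex.exp (-(Complex.I * τ) * y) * Complex.exp (2 * Complex.I * τ * y) =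
      Complex.exp ((Complex.I * τ) * y) := by
    intro y; rw [← Complex.exp_add]; congr 1; ring
  have hI2 : Complex.I ^ 2 = -1 := Complex.I_sq
  have hdA : ∀ y ∈ Icc (-h) h, HasDerivWithinAt A (A' y) (Icc (-h) h) y := by
    intro y hy
    have := ((hd1 y hy).add ((hd2 y hy).div_const (Complex.I * τ))).mul (hE (-(Complex.I * τ)) y)
    refine this.congr_deriv ?_
    simp only [hA', hA, hB, hp]
    rw [mul_assoc _ (Complex.exp _) (Complex.exp _), hcan]
    simp only [Pi.add_apply]
    push_cast
    field_simp
    ring_nf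
    simp only [hI2, show Complex.I ^ 3 = -Complex.I by rw [pow_succ, hI2]; ring]
    ring
  have hdB : ∀ y ∈ Icc (-h) h, HasDerivWithinAt B (B' y) (Icc (-h) h) y := by
    intro y hy
    have := ((hd1 y hy).sub ((hd2 y hy).div_const (Complex.I * τ))).mul (hE (Complex.I * τ) y)
    refine this.congr_deriv ?_
    simp only [hB', hA, hB, hp]
    rw [mul_assoc _ (Complex.exp _) (Complex.exp _), hcan2]
    simp only [Pi.sub_apply]
    push_cast
    field_simp
    ring_nf
    simp only [hI2, show Complex.I ^ 3 = -Complex.I by rw [pow_succ, hI2]; ring]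
    ring
  have hA0 : A 0 = 1 := by simp [hA, hi1, hi2]
  have hB0 : B 0 = 1 := by simp [hB, hi1, hi2]
  have hcA : ContinuousOn A (Icc (-h) h) := fun y hy => (hdA y hy).continuousWithinAt
  have hcB : ContinuousOn B (Icc (-h) h) := fun y hy => (hdB y hy).continuousWithinAt
  have hnI : ‖Complex.I / (2 * τ)‖ = 1 / (2 * ‖τ‖) := by simp
  -- general bound
  have gen : ∀ (u v s : ℂ) (M : ℝ), |s.re| ≤ 2 * T → ‖u‖ ≤ M → ‖v‖ ≤ M → ∀ y ∈ Icc (-h) h,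
      ‖Complex.I / (2 * τ) * ((p y : ℂ) * (u + v * Complex.exp (s * y)))‖ ≤ d ^ 2 * K * M / ‖τ‖ := by
    intro u v s M hs hu hv y hy
    have hM : 0 ≤ M := (norm_nonneg _).trans hu
    have h1 : ‖u + v * Complex.exp (s * y)‖ ≤ 2 * K * M := by
      have := norm_add_le u (v * Complex.exp (s * y))
      rw [norm_mul] at this
      have h2 : ‖v‖ * ‖Complex.exp (s * y)‖ ≤ M * K :=
        mul_le_mul hv (hexp s hs y hy) (norm_nonneg _) hM
      nlinarith
    rw [norm_mul, hnI, norm_mul, Complex.norm_real, Real.norm_eq_abs]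
    calc _ ≤ 1 / (2 * ‖τ‖) * (d ^ 2 * (2 * K * M)) := by
          gcongr
          exact hp_bdd y hy
      _ = _ := by field_simp
  obtain ⟨z, hz, hzmax⟩ := isCompact_Icc.exists_isMaxOn ⟨0, h0⟩
    (f := fun y => max ‖A y‖ ‖B y‖) (hcA.norm.sup hcB.norm)
  set S := max ‖A z‖ ‖B z‖ with hS
  have hSA : ∀ y ∈ Icc (-h) h, ‖A y‖ ≤ S := fun y hy => (le_max_left _ _).trans (hzmax hy)
  have hSB : ∀ y ∈ Icc (-h) h, ‖B y‖ ≤ S := fun y hy => (le_max_right _ _).trans (hzmax hy)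
  have hS0 : 0 ≤ S := (norm_nonneg _).trans (hSA 0 h0)
  have mv : ∀ (F F' : ℝ → ℂ), (∀ y ∈ Icc (-h) h, HasDerivWithinAt F (F' y) (Icc (-h) h) y) →
      F 0 = 1 → (∀ y ∈ Icc (-h) h, ‖F' y‖ ≤ d ^ 2 * K * S / ‖τ‖) →
      ∀ y ∈ Icc (-h) h, ‖F y - 1‖ ≤ d ^ 2 * K * S / ‖τ‖ * h := by
    intro F F' hF hF0 hb y hy
    have := (convex_Icc (-h) h).norm_image_sub_le_of_norm_hasDerivWithin_le hF hb h0 hy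
    rw [hF0] at this
    refine this.trans ?_
    apply mul_le_mul_of_nonneg_left _ (by positivity)
    rw [sub_zero]; exact abs_le.2 hy
  have mA := mv A A' hdA hA0 (fun y hy => gen _ _ _ S hr3 (hSA y hy) (hSB y hy) y hy)
  have mB := mv B B' hdB hB0 (fun y hy => by
    have := gen _ _ _ S hr2 (hSB y hy) (hSA y hy) y hy
    simp only [hB', neg_mul, norm_neg]
    simpa using this)
  have hhalf : d ^ 2 * K * S / ‖τ‖ * h ≤ S / 2 := by
    rw [div_mul_eq_mul_div, div_le_iff₀ hτn]
    nlinarith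
  have hS2 : S ≤ 2 := by
    have h1 : ‖A z‖ ≤ 1 + S / 2 := by
      have := norm_le_norm_sub_add (A z) 1
      rw [norm_one] at this
      linarith [mA z hz]
    have h2 : ‖B z‖ ≤ 1 + S / 2 := by
      have := norm_le_norm_sub_add (B z) 1
      rw [norm_one] at this
      linarith [mB z hz]
    have : S ≤ 1 + S / 2 := max_le h1 h2
    linarith
  set ε : ℝ := d ^ 2 * K * 2 / ‖τ‖ * h with hε
  have hSε : d ^ 2 * K * S / ‖τ‖ * h ≤ ε := by rw [hε]; gcongr
  have eA : ∀ y ∈ Icc (-h) h, ‖A y - 1‖ ≤ ε := fun y hy => (mA y hy).trans hSε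
  have eB : ∀ y ∈ Icc (-h) h, ‖B y - 1‖ ≤ ε := fun y hy => (mB y hy).trans hSε
  have hsub : uIcc 0 x ⊆ Icc (-h) h := ordConnected_Icc.uIcc_subset h0 hx
  have hpi' : IntervalIntegrable (fun y => (p y : ℂ)) volume 0 x := ii_ofReal (hpi 0 h0 x hx)
  have hA'i : IntervalIntegrable A' volume 0 x := by
    apply IntervalIntegrable.const_mul
    apply hpi'.mul_continuousOn
    apply (hcA.mono hsub).add
    apply (hcB.mono hsub).mul
    fun_prop
  have ftc : ∫ y in (0:ℝ)..x, A' y = A x - 1 := by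
    rw [← hA0]
    apply intervalIntegral.integral_eq_sub_of_hasDeriv_right (hcA.mono hsub) _ hA'i
    intro y hy
    have hy1 : y ∈ Ioo (-h) h := by
      have h1 : min 0 x ≥ -h := le_min h0.1 hx.1
      have h2 : max 0 x ≤ h := max_le h0.2 hx.2
      exact ⟨h1.trans_lt hy.1, hy.2.trans_le h2⟩
    exact ((hdA y (Ioo_subset_Icc_self hy1)).hasDerivAt (Icc_mem_nhds hy1.1 hy1.2)).hasDerivWithinAt
  have hJi : IntervalIntegrable (fun y : ℝ => (p y : ℂ) * Complex.exp (-2 * Complex.I * τ * y)) volume 0 x :=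
    hpi'.mul_continuousOn (by fun_prop)
  set J := ∫ y in (0:ℝ)..x, (p y : ℂ) * Complex.exp (-2 * Complex.I * τ * y) with hJ
  have hJb : ‖J‖ ≤ C1 / (2 * ‖τ‖) := by
    have := hosc (-2 * Complex.I * τ) (by simp [hτ]) (hexp _ hr3) 0 h0 x hx
    have e : ‖-2 * Complex.I * τ‖ = 2 * ‖τ‖ := by simp
    rw [e] at this
    exact this
  have hPr : ((∫ y in (0 : ℝ)..x, p y : ℝ) : ℂ) = ∫ y in (0:ℝ)..x, (p y : ℂ) :=
    intervalIntegral.integral_ofReal.symm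
  have hdec : A x - (1 + Complex.I / (2 * τ) * ((∫ y in (0 : ℝ)..x, p y : ℝ) : ℂ)) =
      (∫ y in (0:ℝ)..x, Complex.I / (2 * τ) * ((p y : ℂ) * ((A y - 1) + (B y - 1) * Complex.exp (-2 * Complex.I * τ * y))))
      + Complex.I / (2 * τ) * J := by
    have e : (fun y : ℝ => Complex.I / (2 * τ) * ((p y : ℂ) * ((A y - 1) + (B y - 1) * Complex.exp (-2 * Complex.I * τ * y))))
        = fun y : ℝ => A' y - Complex.I / (2 * τ) * ((p y : ℂ) + (p y : ℂ) * Complex.exp (-2 * Complex.I * τ * y)) := by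
      funext y; simp only [hA']; ring
    rw [e, intervalIntegral.integral_sub hA'i ((hpi'.add hJi).const_mul _), ftc,
      intervalIntegral.integral_const_mul, intervalIntegral.integral_add hpi' hJi, hPr, ← hJ]
    ring
  have hmain : ‖A x - (1 + Complex.I / (2 * τ) * ((∫ y in (0 : ℝ)..x, p y : ℝ) : ℂ))‖ ≤
      (2 * d ^ 4 * K ^ 2 * h ^ 2 + C1) / ‖τ‖ ^ 2 := by
    rw [hdec]
    have b1 : ‖∫ y in (0:ℝ)..x, Complex.I / (2 * τ) * ((p y : ℂ) * ((A y - 1) + (B y - 1) * Complex.exp (-2 * Complex.I * τ * y)))‖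
        ≤ d ^ 2 * K * ε / ‖τ‖ * |x - 0| := by
      apply intervalIntegral.norm_integral_le_of_norm_le_const
      intro y hy
      have hy' := hsub (uIoc_subset_uIcc hy)
      exact gen _ _ _ ε hr3 (eA y hy') (eB y hy') y hy'
    have b2 : d ^ 2 * K * ε / ‖τ‖ * |x - 0| ≤ d ^ 2 * K * ε / ‖τ‖ * h := by
      apply mul_le_mul_of_nonneg_left _ (by positivity)
      rw [sub_zero]; exact abs_le.2 hx
    have b3 : ‖Complex.I / (2 * τ) * J‖ ≤ C1 / ‖τ‖ ^ 2 := by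
      rw [norm_mul, hnI]
      calc _ ≤ 1 / (2 * ‖τ‖) * (C1 / (2 * ‖τ‖)) := by gcongr
        _ = C1 / ‖τ‖ ^ 2 / 4 := by field_simp; ring
        _ ≤ _ := by
          have : 0 ≤ C1 / ‖τ‖ ^ 2 := by positivity
          linarith
    calc _ ≤ _ := norm_add_le _ _
      _ ≤ d ^ 2 * K * ε / ‖τ‖ * h + C1 / ‖τ‖ ^ 2 := add_le_add (b1.trans b2) b3
      _ = _ := by rw [hε]; field_simp
  have hfin : (φ τ x + φd τ x / (Complex.I * τ)) -
            (1 + Complex.I / (2 * τ) * ((∫ y in (0 : ℝ)..x, p y : ℝ) : ℂ)) *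
              Complex.exp (Complex.I * τ * (x : ℂ)) =
      (A x - (1 + Complex.I / (2 * τ) * ((∫ y in (0 : ℝ)..x, p y : ℝ) : ℂ))) *
        Complex.exp (Complex.I * τ * (x : ℂ)) := by
    have : Complex.exp (-(Complex.I * τ) * x) * Complex.exp (Complex.I * τ * (x : ℂ)) = 1 := by
      rw [← Complex.exp_add]; simp
    simp only [hA]
    rw [sub_mul, mul_assoc _ (Complex.exp _) (Complex.exp _), this, mul_one]
  rw [hfin, norm_mul]
  calc _ ≤ (2 * d ^ 4 * K ^ 2 * h ^ 2 + C1) / ‖τ‖ ^ 2 * K :=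
        mul_le_mul hmain (hexp _ hr1 x hx) (norm_nonneg _) (by positivity)
    _ = K * (2 * d ^ 4 * K ^ 2 * h ^ 2 + C1) / ‖τ‖ ^ 2 := by ring
    _ ≤ _ := by gcongr; linarith
end
end

section
/- Let T > 0, h > 0, d > 0, and let q : [−h, h] → ℝ be of bounded variation with 0 ≤ q(x) ≤ d²; set p(x) = d² − q(x). For τ ∈ ℂ \ {0} set λ = d² + τ², and let φ_a(·, λ) : [−h, h] → ℂ be the solution of φ'' + (λ − q(x)) φ = 0 with φ_a(0, λ) = 0, φ_a'(0, λ) = √λ (principal branch). Define Φ_a(x, τ) = φ_a(x, λ) + φ_a'(x, λ)/(iτ). Then there exist constants C > 0 and R₀ > 0 such that for all τ with |Im τ| ≤ T and |τ| ≥ R₀, and all x ∈ [−h, h], one has | Φ_a(x, τ) − ( √(τ² + d²) / (iτ) ) [ 1 + (i/(2τ)) ∫₀^x p(y) dy ] e^{iτx} | ≤ C / |τ|². -/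
open MeasureTheory Set Complex
open scoped ENNReal NNReal

noncomputable section

theorem osc_piece (f : ℝ → ℝ) (e E : ℝ → ℂ) (a b M N u v : ℝ)
    (hf : MonotoneOn f (Icc a b)) (he : Continuous e) (hM : ∀ x ∈ Icc a b, ‖e x‖ ≤ M)
    (hE : ∀ x, HasDerivAt E (e x) x) (hN : ∀ x ∈ Icc a b, ‖E x‖ ≤ N)
    (hau : a ≤ u) (huv : u ≤ v) (hvb : v ≤ b) :
    ‖(∫ y in u..v, (f y : ℂ) * e y) - f v * E v + f u * E u‖
      ≤ (f v - f u) * (N + M * (v - u)) := by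
  have hsub : Icc u v ⊆ Icc a b := Icc_subset_Icc hau hvb
  have hfi : IntervalIntegrable f volume u v :=
    MonotoneOn.intervalIntegrable (by rw [uIcc_of_le huv]; exact hf.mono hsub)
  have hfi' : IntervalIntegrable (fun y => (f y : ℂ)) volume u v := 
    ⟨hfi.1.ofReal, hfi.2.ofReal⟩
  have h1 : IntervalIntegrable (fun y => (f y : ℂ) * e y) volume u v :=
    hfi'.mul_continuousOn he.continuousOn
  have h2 : IntervalIntegrable (fun y => (f u : ℂ) * e y) volume u v :=
    (continuous_const.mul he).intervalIntegrable _ _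
  have h3 : ∫ y in u..v, e y = E v - E u :=
    intervalIntegral.integral_eq_sub_of_hasDerivAt (fun x _ => hE x) (he.intervalIntegrable _ _)
  have h4 : (∫ y in u..v, (f y : ℂ) * e y) - f v * E v + f u * E u
      = (∫ y in u..v, ((f y : ℂ) - f u) * e y) - ((f v - f u : ℝ) : ℂ) * E v := by
    have : (∫ y in u..v, ((f y : ℂ) - f u) * e y) =
        (∫ y in u..v, (f y : ℂ) * e y) - f u * (E v - E u) := by
      simp_rw [sub_mul]
      rw [intervalIntegral.integral_sub h1 h2, intervalIntegral.integral_const_mul, h3]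
    rw [this]; push_cast; ring
  have hu : u ∈ Icc a b := ⟨hau, huv.trans hvb⟩
  have hv : v ∈ Icc a b := ⟨hau.trans huv, hvb⟩
  have hfuv : 0 ≤ f v - f u := sub_nonneg.2 (hf hu hv huv)
  have h5 : ‖∫ y in u..v, ((f y : ℂ) - f u) * e y‖ ≤ ((f v - f u) * M) * |v - u| := by
    apply intervalIntegral.norm_integral_le_of_norm_le_const
    intro y hy
    rw [uIoc_of_le huv] at hy
    have hy' : y ∈ Icc a b := hsub ⟨hy.1.le, hy.2⟩
    rw [norm_mul, ← Complex.ofReal_sub, Complex.norm_real, Real.norm_eq_abs,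
      abs_of_nonneg (sub_nonneg.2 (hf hu hy' hy.1.le))]
    exact mul_le_mul (by linarith [hf hy' hv hy.2]) (hM y hy') (norm_nonneg _) hfuv
  rw [abs_of_nonneg (by linarith)] at h5
  have h6 : ‖((f v - f u : ℝ) : ℂ) * E v‖ ≤ (f v - f u) * N := by
    rw [norm_mul, Complex.norm_real, Real.norm_eq_abs, abs_of_nonneg hfuv]
    exact mul_le_mul_of_nonneg_left (hN v hv) hfuv
  rw [h4]
  refine (norm_sub_le _ _).trans ?_
  nlinarith

theorem osc_mono_s10 (f : ℝ → ℝ) (e E : ℝ → ℂ) (a b M N : ℝ) (hab : a ≤ b) (hN0 : 0 < N)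
    (hf : MonotoneOn f (Icc a b)) (he : Continuous e) (hM : ∀ x ∈ Icc a b, ‖e x‖ ≤ M)
    (hE : ∀ x, HasDerivAt E (e x) x) (hN : ∀ x ∈ Icc a b, ‖E x‖ ≤ N) :
    ‖(∫ y in a..b, (f y : ℂ) * e y) - f b * E b + f a * E a‖ ≤ (f b - f a) * (2 * N) := by
  obtain ⟨n, hn⟩ := exists_nat_gt (M * (b - a) / N)
  have hM0 : 0 ≤ M := (norm_nonneg _).trans (hM a ⟨le_rfl, hab⟩)
  have hn0 : (0 : ℝ) < n := lt_of_le_of_lt (by have := sub_nonneg.2 hab; positivity) hn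
  set δ := (b - a) / n with hδ
  have hδ0 : 0 ≤ δ := div_nonneg (sub_nonneg.2 hab) hn0.le
  have hnδ : n * δ = b - a := by rw [hδ]; field_simp
  have hMδ : M * δ ≤ N := by
    rw [div_lt_iff₀ hN0] at hn
    rw [hδ, ← mul_div_assoc, div_le_iff₀ hn0]; linarith
  have key : ∀ k : ℕ, k ≤ n → 
     ‖(∫ y in a..(a + k * δ), (f y : ℂ) * e y) - f (a + k * δ) * E (a + k * δ) + f a * E a‖
       ≤ (f (a + k * δ) - f a) * (2 * N) := by
    intro k
    induction k with
    | zero => intro _; simp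
    | succ k ih =>
      intro hk
      have hk' : ((k + 1 : ℕ) : ℝ) ≤ n := by exact_mod_cast hk
      have hkb : a + ((k + 1 : ℕ) : ℝ) * δ ≤ b := by nlinarith
      have hk0 : 0 ≤ (k : ℝ) * δ := by positivity
      have hstep : a + (k : ℝ) * δ ≤ a + ((k + 1 : ℕ) : ℝ) * δ := by push_cast; nlinarith
      have h1 := ih (by omega)
      have h2 := osc_piece f e E a b M N (a + k * δ) (a + ((k + 1 : ℕ) : ℝ) * δ) hf he hM hE hN
        (by linarith) hstep hkb
      have h3 : a + ((k + 1 : ℕ) : ℝ) * δ - (a + k * δ) = δ := by push_cast; ring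
      rw [h3] at h2
      set v := a + ((k + 1 : ℕ) : ℝ) * δ
      set u := a + (k : ℝ) * δ
      have hint : ∀ s t, s ∈ Icc a b → t ∈ Icc a b →
          IntervalIntegrable (fun y => (f y : ℂ) * e y) volume s t := by
        intro s t hs ht
        have hfi : IntervalIntegrable f volume s t :=
          MonotoneOn.intervalIntegrable (hf.mono (uIcc_subset_Icc hs ht))
        have hfi' : IntervalIntegrable (fun y => (f y : ℂ)) volume s t := 
          ⟨hfi.1.ofReal, hfi.2.ofReal⟩
        exact hfi'.mul_continuousOn he.continuousOn
      have hu : u ∈ Icc a b := ⟨by linarith, by linarith⟩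
      have hv : v ∈ Icc a b := ⟨by linarith, by linarith⟩
      have ha : a ∈ Icc a b := ⟨le_rfl, hab⟩
      have hadd := intervalIntegral.integral_add_adjacent_intervals (hint a u ha hu) (hint u v hu hv)
      have : (∫ y in a..v, (f y : ℂ) * e y) - f v * E v + f a * E a =
        ((∫ y in a..u, (f y : ℂ) * e y) - f u * E u + f a * E a) +
        ((∫ y in u..v, (f y : ℂ) * e y) - f v * E v + f u * E u) := by rw [← hadd]; ring
      rw [this]
      refine (norm_add_le _ _).trans ?_
      have := hf hu hv hstep
      nlinarith
  have := key n le_rfl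
  rwa [hnδ, add_sub_cancel] at this

theorem osc_bound (f : ℝ → ℝ) (e E : ℝ → ℂ) (h M N x : ℝ) (hh : 0 < h) (hN0 : 0 < N)
    (hf : MonotoneOn f (Icc (-h) h)) (he : Continuous e) (hM : ∀ x ∈ Icc (-h) h, ‖e x‖ ≤ M)
    (hE : ∀ x, HasDerivAt E (e x) x) (hN : ∀ x ∈ Icc (-h) h, ‖E x‖ ≤ N)
    (hx : x ∈ Icc (-h) h) :
    ‖∫ y in (0:ℝ)..x, (f y : ℂ) * e y‖ ≤ 6 * N * (|f (-h)| + |f h|) := by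
  have gen : ∀ a b, a ≤ b → a ∈ Icc (-h) h → b ∈ Icc (-h) h →
      ‖∫ y in a..b, (f y : ℂ) * e y‖ ≤ 6 * N * (|f (-h)| + |f h|) := by
    intro a b hab ha hb
    have hs : Icc a b ⊆ Icc (-h) h := Icc_subset_Icc ha.1 hb.2
    have h1 := osc_mono_s10 f e E a b M N hab hN0 (hf.mono hs) he (fun x hx => hM x (hs hx)) hE
      (fun x hx => hN x (hs hx))
    have hbd : ∀ y ∈ Icc (-h) h, |f y| ≤ |f (-h)| + |f h| := by
      intro y hy
      have h1 := hf ⟨le_rfl, by linarith⟩ hy hy.1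
      have h2 := hf hy ⟨by linarith, le_rfl⟩ hy.2
      rw [abs_le]
      constructor
      · linarith [neg_abs_le (f (-h)), abs_nonneg (f h)]
      · linarith [le_abs_self (f h), abs_nonneg (f (-h))]
    set F := |f (-h)| + |f h|
    have hF : 0 ≤ F := by positivity
    have t1 : ∀ y ∈ Icc (-h) h, ‖(f y : ℂ) * E y‖ ≤ F * N := by
      intro y hy
      rw [norm_mul, Complex.norm_real]
      exact mul_le_mul (hbd y hy) (hN y hy) (norm_nonneg _) hF
    have e1 : (∫ y in a..b, (f y : ℂ) * e y) =
      ((∫ y in a..b, (f y : ℂ) * e y) - f b * E b + f a * E a) + (f b * E b - f a * E a) := by ring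
    rw [e1]
    refine (norm_add_le _ _).trans ?_
    have e2 := norm_sub_le ((f b : ℂ) * E b) (f a * E a)
    have := abs_le.1 (hbd a ha)
    have := abs_le.1 (hbd b hb)
    have := t1 a ha
    have := t1 b hb
    nlinarith
  have h0 : (0:ℝ) ∈ Icc (-h) h := ⟨by linarith, hh.le⟩
  rcases le_total 0 x with h | h
  · exact gen 0 x h h0 hx
  · rw [intervalIntegral.integral_symm, norm_neg]
    exact gen x 0 h hx h0

theorem core_est (A B g g' P : ℝ → ℂ) (c s : ℂ) (h D W J : ℝ) (hh : 0 < h) (hD : 0 ≤ D)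
    (hW : 0 ≤ W)
    (hA : ∀ x ∈ Icc (-h) h, HasDerivWithinAt A (c * (P x * (A x + g x * B x))) (Icc (-h) h) x)
    (hB : ∀ x ∈ Icc (-h) h, HasDerivWithinAt B (-c * (P x * (B x + g' x * A x))) (Icc (-h) h) x)
    (hP : ∀ x ∈ Icc (-h) h, ‖P x‖ ≤ D) (hg : ∀ x ∈ Icc (-h) h, ‖g x‖ ≤ W)
    (hg' : ∀ x ∈ Icc (-h) h, ‖g' x‖ ≤ W) (hgc : Continuous g)
    (hPi : ∀ x ∈ Icc (-h) h, IntervalIntegrable P volume 0 x)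
    (hA0 : A 0 = s) (hB0 : B 0 = -s) (hc : ‖c‖ * (D * (1 + W) * h) ≤ 1 / 2)
    (hJ : ∀ x ∈ Icc (-h) h, ‖∫ y in (0:ℝ)..x, P y * g y‖ ≤ J) (x : ℝ) (hx : x ∈ Icc (-h) h) :
    ‖A x - s * (1 + c * ∫ y in (0:ℝ)..x, P y)‖
      ≤ 2 * ‖c‖ ^ 2 * (D * (1 + W) * h) ^ 2 * ‖s‖ + ‖c‖ * ‖s‖ * J := by
  have h0 : (0:ℝ) ∈ Icc (-h) h := ⟨by linarith, hh.le⟩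
  have hAc : ContinuousOn A (Icc (-h) h) := fun x hx => (hA x hx).continuousWithinAt
  have hBc : ContinuousOn B (Icc (-h) h) := fun x hx => (hB x hx).continuousWithinAt
  obtain ⟨z, hz, hzm⟩ := isCompact_Icc.exists_isMaxOn ⟨0, h0⟩ (hAc.norm.sup hBc.norm)
  set M := max ‖A z‖ ‖B z‖ with hMdef
  have hM : ∀ x ∈ Icc (-h) h, max ‖A x‖ ‖B x‖ ≤ M := fun x hx => hzm hx
  have hMA : ∀ x ∈ Icc (-h) h, ‖A x‖ ≤ M := fun x hx => (le_max_left _ _).trans (hM x hx)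
  have hMB : ∀ x ∈ Icc (-h) h, ‖B x‖ ≤ M := fun x hx => (le_max_right _ _).trans (hM x hx)
  have hM0 : 0 ≤ M := (norm_nonneg _).trans (hMA 0 h0)
  have habs : ∀ x ∈ Icc (-h) h, |x| ≤ h := fun x hx => abs_le.2 hx
  set L := D * (1 + W) * h with hL
  have comb : ∀ (p u v k : ℂ) (m : ℝ), ‖p‖ ≤ D → ‖u‖ ≤ m → ‖v‖ ≤ m → ‖k‖ ≤ W →
      ‖p * (u + k * v)‖ ≤ D * (1 + W) * m := by
    intro p u v k m hp hu hv hk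
    have hm : 0 ≤ m := (norm_nonneg _).trans hu
    have : ‖u + k * v‖ ≤ (1 + W) * m := by
      refine (norm_add_le _ _).trans ?_
      rw [norm_mul]
      have := mul_le_mul hk hv (norm_nonneg _) hW
      linarith
    rw [norm_mul, mul_assoc]
    exact mul_le_mul hp this (norm_nonneg _) hD
  have dA : ∀ x ∈ Icc (-h) h, ‖A x - s‖ ≤ ‖c‖ * L * M := by
    intro x hx
    have := (convex_Icc (-h) h).norm_image_sub_le_of_norm_hasDerivWithin_le hA
      (C := ‖c‖ * (D * (1 + W) * M)) (fun y hy => by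
        rw [norm_mul]
        exact mul_le_mul_of_nonneg_left
          (comb _ _ _ _ _ (hP y hy) (hMA y hy) (hMB y hy) (hg y hy)) (norm_nonneg _)) h0 hx
    rw [hA0, sub_zero, Real.norm_eq_abs] at this
    refine this.trans ((mul_le_mul_of_nonneg_left (habs x hx) (by positivity)).trans (le_of_eq ?_))
    rw [hL]; ring
  have dB : ∀ x ∈ Icc (-h) h, ‖B x + s‖ ≤ ‖c‖ * L * M := by
    intro x hx
    have := (convex_Icc (-h) h).norm_image_sub_le_of_norm_hasDerivWithin_le hB
      (C := ‖c‖ * (D * (1 + W) * M)) (fun y hy => by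
        rw [norm_mul, norm_neg]
        exact mul_le_mul_of_nonneg_left
          (comb _ _ _ _ _ (hP y hy) (hMB y hy) (hMA y hy) (hg' y hy)) (norm_nonneg _)) h0 hx
    rw [hB0, sub_zero, sub_neg_eq_add, Real.norm_eq_abs] at this
    refine this.trans ((mul_le_mul_of_nonneg_left (habs x hx) (by positivity)).trans (le_of_eq ?_))
    rw [hL]; ring
  have hMs : M ≤ 2 * ‖s‖ := by
    have e1 : ‖A z‖ ≤ ‖s‖ + ‖c‖ * L * M := by
      have := norm_add_le (A z - s) s
      rw [sub_add_cancel] at this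
      linarith [dA z hz]
    have e2 : ‖B z‖ ≤ ‖s‖ + ‖c‖ * L * M := by
      have := norm_sub_le (B z + s) s
      rw [add_sub_cancel_right] at this
      linarith [dB z hz]
    have : M ≤ ‖s‖ + ‖c‖ * L * M := max_le e1 e2
    nlinarith
  have hL0 : 0 ≤ L := by positivity
  have hm : ‖c‖ * L * M ≤ 2 * ‖c‖ * L * ‖s‖ := by
    have : 0 ≤ ‖c‖ * L := by positivity
    nlinarith
  have hsub : uIcc 0 x ⊆ Icc (-h) h := uIcc_subset_Icc h0 hx
  have hP' := hPi x hx
  have i1 : IntervalIntegrable (fun y => P y * (A y + g y * B y)) volume 0 x :=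
    hP'.mul_continuousOn ((hAc.add (hgc.continuousOn.mul hBc)).mono hsub)
  have i2 : IntervalIntegrable (fun y => P y * ((A y - s) + g y * (B y + s))) volume 0 x :=
    hP'.mul_continuousOn (((hAc.sub continuousOn_const).add
      (hgc.continuousOn.mul (hBc.add continuousOn_const))).mono hsub)
  have i3 : IntervalIntegrable (fun y => P y * g y) volume 0 x :=
    hP'.mul_continuousOn hgc.continuousOn
  have ftc : ∫ y in (0:ℝ)..x, c * (P y * (A y + g y * B y)) = A x - A 0 := by
    apply intervalIntegral.integral_eq_sub_of_hasDeriv_right (hAc.mono hsub) _ (i1.const_mul c)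
    intro y hy
    have hy2 : y ∈ Ioo (-h) h := by
      constructor
      · exact lt_of_le_of_lt (le_min h0.1 hx.1) hy.1
      · exact lt_of_lt_of_le hy.2 (max_le h0.2 hx.2)
    exact ((hA y (Ioo_subset_Icc_self hy2)).hasDerivAt (Icc_mem_nhds hy2.1 hy2.2)).hasDerivWithinAt
  have split : ∫ y in (0:ℝ)..x, P y * (A y + g y * B y) =
      (∫ y in (0:ℝ)..x, P y * ((A y - s) + g y * (B y + s))) + (s * (∫ y in (0:ℝ)..x, P y)
        - s * ∫ y in (0:ℝ)..x, P y * g y) := by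
    rw [← intervalIntegral.integral_const_mul, ← intervalIntegral.integral_const_mul,
      ← intervalIntegral.integral_sub (hP'.const_mul s) (i3.const_mul s),
      ← intervalIntegral.integral_add i2 ((hP'.const_mul s).sub (i3.const_mul s))]
    congr 1; ext y; ring
  rw [intervalIntegral.integral_const_mul, split, hA0] at ftc
  have fin : A x - s * (1 + c * ∫ y in (0:ℝ)..x, P y) =
      c * (∫ y in (0:ℝ)..x, P y * ((A y - s) + g y * (B y + s)))
       - c * s * ∫ y in (0:ℝ)..x, P y * g y := by linear_combination -ftc
  have bd : ‖∫ y in (0:ℝ)..x, P y * ((A y - s) + g y * (B y + s))‖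
      ≤ D * (1 + W) * (2 * ‖c‖ * L * ‖s‖) * |x - 0| := by
    apply intervalIntegral.norm_integral_le_of_norm_le_const
    intro y hy
    have hy := hsub (uIoc_subset_uIcc hy)
    exact comb _ _ _ _ _ (hP y hy) ((dA y hy).trans hm) ((dB y hy).trans hm) (hg y hy)
  have bd2 : ‖∫ y in (0:ℝ)..x, P y * ((A y - s) + g y * (B y + s))‖
      ≤ 2 * ‖c‖ * L ^ 2 * ‖s‖ := by
    refine bd.trans ?_
    rw [sub_zero]
    refine (mul_le_mul_of_nonneg_left (habs x hx) (by positivity)).trans (le_of_eq ?_)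
    rw [hL]; ring
  rw [fin]
  refine (norm_sub_le _ _).trans ?_
  rw [norm_mul, norm_mul, norm_mul]
  have t1 := mul_le_mul_of_nonneg_left bd2 (norm_nonneg c)
  have t2 := mul_le_mul_of_nonneg_left (hJ x hx) (show 0 ≤ ‖c‖ * ‖s‖ by positivity)
  nlinarith

theorem exp_bd (τ : ℂ) (T h x k : ℝ) (hT : |τ.im| ≤ T) (hx : x ∈ Icc (-h) h) :
    ‖Complex.exp (k * (Complex.I * τ * x))‖ ≤ Real.exp (|k| * T * h) := by
  rw [Complex.norm_exp]
  apply Real.exp_le_exp.2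
  have : (k * (Complex.I * τ * x) : ℂ).re = -(k * τ.im * x) := by simp; ring
  rw [this]
  refine (neg_le_abs _).trans ?_
  rw [abs_mul, abs_mul]
  have := abs_le.2 hx
  have hT0 : 0 ≤ T := (abs_nonneg _).trans hT
  gcongr

theorem bv_osc (T h d : ℝ) (hh : 0 < h) 
    (q : ℝ → ℝ) (hq_bv : BoundedVariationOn q (Set.Icc (-h) h)) :
    (∀ x ∈ Icc (-h) h, IntervalIntegrable (fun y => ((d ^ 2 - q y : ℝ) : ℂ)) volume 0 x) ∧
    ∃ K, 0 ≤ K ∧ ∀ τ : ℂ, τ ≠ 0 → |τ.im| ≤ T → ∀ x ∈ Icc (-h) h,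
      ‖∫ y in (0:ℝ)..x, ((d ^ 2 - q y : ℝ) : ℂ) * Complex.exp ((-2 : ℝ) * (Complex.I * τ * y))‖
        ≤ K / ‖τ‖ := by
  obtain ⟨f, g, hf, hg, rfl⟩ := hq_bv.locallyBoundedVariationOn.exists_monotoneOn_sub_monotoneOn
  have h0 : (0:ℝ) ∈ Icc (-h) h := ⟨by linarith, hh.le⟩
  have hg2 : MonotoneOn (fun y => d ^ 2 + g y) (Icc (-h) h) := fun a ha b hb hab => by
    have := hg ha hb hab
    simpa using this
  have hi : ∀ u : ℝ → ℝ, MonotoneOn u (Icc (-h) h) → ∀ x ∈ Icc (-h) h,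
      IntervalIntegrable (fun y => (u y : ℂ)) volume 0 x := by
    intro u hu x hx
    have hfi : IntervalIntegrable u volume 0 x :=
      MonotoneOn.intervalIntegrable (hu.mono (uIcc_subset_Icc h0 hx))
    exact ⟨hfi.1.ofReal, hfi.2.ofReal⟩
  have hrw : ∀ y, ((d ^ 2 - (f - g) y : ℝ) : ℂ) = ((d ^ 2 + g y : ℝ) : ℂ) - (f y : ℂ) := by
    intro y; simp; ring
  simp_rw [hrw]
  refine ⟨fun x hx => (hi _ hg2 x hx).sub (hi f hf x hx), ?_⟩
  set W := Real.exp (2 * T * h) with hWd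
  refine ⟨6 * W * (|d ^ 2 + g (-h)| + |d ^ 2 + g h|) + 6 * W * (|f (-h)| + |f h|),
    by positivity, ?_⟩
  intro τ hτ hτT x hx
  set e : ℝ → ℂ := fun y => Complex.exp ((-2 : ℝ) * (Complex.I * τ * y)) with he
  set E : ℝ → ℂ := fun y => e y / (-2 * (Complex.I * τ)) with hEd
  have hec : Continuous e := by rw [he]; fun_prop
  have hM : ∀ x ∈ Icc (-h) h, ‖e x‖ ≤ W := by
    intro x hx
    have := exp_bd τ T h x (-2) hτT hx
    simpa [he, hWd] using this
  have hn : 0 < ‖τ‖ := norm_pos_iff.2 hτ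
  have hE : ∀ x, HasDerivAt E (e x) x := by
    intro x
    have h1 : HasDerivAt (fun y : ℝ => ((-2 : ℝ) : ℂ) * (Complex.I * τ * y))
        (((-2 : ℝ) : ℂ) * (Complex.I * τ * 1)) x :=
      ((Complex.ofRealCLM.hasDerivAt (x := x)).const_mul _).const_mul _
    have h2 := h1.cexp.div_const (-2 * (Complex.I * τ))
    refine h2.congr_deriv ?_
    show Complex.exp ((-2 : ℝ) * (Complex.I * τ * x)) * _ / _ = Complex.exp ((-2 : ℝ) * (Complex.I * τ * x))
    generalize Complex.exp _ = w
    have := Complex.I_ne_zero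
    push_cast
    field_simp
  have hN : ∀ x ∈ Icc (-h) h, ‖E x‖ ≤ W / ‖τ‖ := by
    intro x hx
    show ‖e x / (-2 * (Complex.I * τ))‖ ≤ W / ‖τ‖
    rw [norm_div]
    have : ‖(-2 * (Complex.I * τ))‖ = 2 * ‖τ‖ := by simp
    rw [this]
    apply div_le_div₀ (by positivity) (hM x hx) hn (by linarith)
  have hN0 : 0 < W / ‖τ‖ := by positivity
  have b1 := osc_bound _ e E h W _ x hh hN0 hg2 hec hM hE hN hx
  have b2 := osc_bound _ e E h W _ x hh hN0 hf hec hM hE hN hx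
  simp_rw [sub_mul]
  rw [intervalIntegral.integral_sub ((hi _ hg2 x hx).mul_continuousOn hec.continuousOn)
    ((hi f hf x hx).mul_continuousOn hec.continuousOn)]
  refine (norm_sub_le _ _).trans ((add_le_add b1 b2).trans (le_of_eq ?_))
  ring

/-- **Asymptotic estimate for `Φ_a`.**  Let `q` be of bounded variation on `[-h,h]` with
`0 ≤ q ≤ d²`, and for each `τ ≠ 0` let `φ τ` be the solution of
`φ'' + (d² + τ² - q(x)) φ = 0` on `[-h,h]` with `φ(0) = 0`, `φ'(0) = √(d² + τ²)`
(principal branch; the derivative being `φd τ`).  Then `Φ_a(x,τ) = φ(x) + φ'(x)/(iτ)`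
satisfies `Φ_a(x,τ) = (√(τ²+d²)/(iτ)) [1 + (i/(2τ)) ∫₀ˣ (d² - q)] e^{iτx} + O(1/|τ|²)`
uniformly for `x ∈ [-h,h]` and `|Im τ| ≤ T`. -/
theorem Phi_a_asymptotics
    (T h d : ℝ) (hT : 0 < T) (hh : 0 < h) (hd : 0 < d)
    (q : ℝ → ℝ) (hq_bv : BoundedVariationOn q (Set.Icc (-h) h))
    (hq_bdd : ∀ x ∈ Set.Icc (-h) h, 0 ≤ q x ∧ q x ≤ d ^ 2)
    (φ φd : ℂ → ℝ → ℂ)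
    (hφ : ∀ τ : ℂ, τ ≠ 0 → ∀ x ∈ Set.Icc (-h) h,
      HasDerivWithinAt (φ τ) (φd τ x) (Set.Icc (-h) h) x)
    (hφd : ∀ τ : ℂ, τ ≠ 0 → ∀ x ∈ Set.Icc (-h) h,
      HasDerivWithinAt (φd τ)
        (-((((d : ℂ) ^ 2 + τ ^ 2) - ((q x : ℝ) : ℂ)) * φ τ x)) (Set.Icc (-h) h) x)
    (hinit : ∀ τ : ℂ, τ ≠ 0 → φ τ 0 = 0 ∧ φd τ 0 = ((d : ℂ) ^ 2 + τ ^ 2) ^ ((1 : ℂ) / 2)) :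
    ∃ C > 0, ∃ R₀ > 0, ∀ τ : ℂ, τ ≠ 0 → |τ.im| ≤ T → R₀ ≤ ‖τ‖ →
      ∀ x ∈ Set.Icc (-h) h,
        ‖(φ τ x + φd τ x / (Complex.I * τ)) -
            ((τ ^ 2 + (d : ℂ) ^ 2) ^ ((1 : ℂ) / 2) / (Complex.I * τ)) *
              (1 + Complex.I / (2 * τ) *
                ((∫ y in (0 : ℝ)..x, (d ^ 2 - q y) : ℝ) : ℂ)) *
              Complex.exp (Complex.I * τ * (x : ℂ))‖ ≤ C / ‖τ‖ ^ 2 := by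
  classical
  obtain ⟨hPi, K, hK0, hK⟩ := bv_osc T h d hh q hq_bv
  set W := Real.exp (2 * T * h) with hWd
  have hW0 : 0 ≤ W := (Real.exp_pos _).le
  set L := d ^ 2 * (1 + W) * h with hL
  have hL0 : 0 < L := by positivity
  set V := Real.exp (1 * T * h) with hVd
  have hV0 : 0 < V := Real.exp_pos _
  refine ⟨V * (L ^ 2 + K), by positivity, d + L, by positivity, ?_⟩
  intro τ hτ hτT hR x hx
  have hn : 0 < ‖τ‖ := norm_pos_iff.2 hτ
  have hI := Complex.I_ne_zero
  have h0 : (0:ℝ) ∈ Icc (-h) h := ⟨by linarith, hh.le⟩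
  set r : ℂ := ((d : ℂ) ^ 2 + τ ^ 2) ^ ((1 : ℂ) / 2) with hr
  have hr2 : r ^ 2 = (d : ℂ) ^ 2 + τ ^ 2 := by
    have := Complex.cpow_nat_inv_pow ((d : ℂ) ^ 2 + τ ^ 2) (n := 2) two_ne_zero
    rw [hr, one_div]; exact_mod_cast this
  have hrn : ‖r‖ ≤ 2 * ‖τ‖ := by
    have h1 : ‖r‖ ^ 2 ≤ d ^ 2 + ‖τ‖ ^ 2 := by
      rw [← norm_pow, hr2]
      refine (norm_add_le _ _).trans (le_of_eq ?_)
      simp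
    nlinarith [norm_nonneg r]
  set s : ℂ := r / (Complex.I * τ) with hs
  have hsn : ‖s‖ ≤ 2 := by
    rw [hs, norm_div, norm_mul, Complex.norm_I, one_mul, div_le_iff₀ hn]; exact hrn
  set c : ℂ := Complex.I / (2 * τ) with hc
  have hcn : ‖c‖ = 1 / (2 * ‖τ‖) := by rw [hc]; simp
  set P : ℝ → ℂ := fun y => ((d ^ 2 - q y : ℝ) : ℂ) with hP
  set A : ℝ → ℂ := fun y => Complex.exp ((-1 : ℝ) * (Complex.I * τ * y)) *
    (φ τ y + φd τ y / (Complex.I * τ)) with hA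
  set B : ℝ → ℂ := fun y => Complex.exp ((1 : ℝ) * (Complex.I * τ * y)) *
    (φ τ y - φd τ y / (Complex.I * τ)) with hB
  set g : ℝ → ℂ := fun y => Complex.exp ((-2 : ℝ) * (Complex.I * τ * y)) with hg
  set g' : ℝ → ℂ := fun y => Complex.exp ((2 : ℝ) * (Complex.I * τ * y)) with hg'
  have hexp : ∀ (k : ℝ) (y : ℝ), HasDerivWithinAt
      (fun y : ℝ => Complex.exp ((k : ℂ) * (Complex.I * τ * y)))
      (Complex.exp ((k : ℂ) * (Complex.I * τ * y)) * ((k : ℂ) * (Complex.I * τ * 1)))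
      (Icc (-h) h) y := by
    intro k y
    have h1 : HasDerivAt (fun y : ℝ => (k : ℂ) * (Complex.I * τ * y))
        ((k : ℂ) * (Complex.I * τ * 1)) y :=
      ((Complex.ofRealCLM.hasDerivAt (x := y)).const_mul _).const_mul _
    exact h1.cexp.hasDerivWithinAt
  have hgA : ∀ y : ℝ, g y * Complex.exp ((1 : ℝ) * (Complex.I * τ * y))
      = Complex.exp ((-1 : ℝ) * (Complex.I * τ * y)) := by
    intro y; rw [hg, ← Complex.exp_add]; congr 1; push_cast; ring
  have hgB : ∀ y : ℝ, g' y * Complex.exp ((-1 : ℝ) * (Complex.I * τ * y))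
      = Complex.exp ((1 : ℝ) * (Complex.I * τ * y)) := by
    intro y; rw [hg', ← Complex.exp_add]; congr 1; push_cast; ring
  have hI2 := Complex.I_sq
  have hIinv : ∀ z : ℂ, z / (Complex.I * τ) = -Complex.I * z / τ := by
    intro z; field_simp; linear_combination z * hI2
  have dA : ∀ y ∈ Icc (-h) h,
      HasDerivWithinAt A (c * (P y * (A y + g y * B y))) (Icc (-h) h) y := by
    intro y hy
    have h1 := (hexp (-1) y).mul ((hφ τ hτ y hy).add ((hφd τ hτ y hy).div_const (Complex.I * τ)))
    refine h1.congr_deriv ?_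
    have e1 : A y + g y * B y = Complex.exp ((-1 : ℝ) * (Complex.I * τ * y)) * (2 * φ τ y) := by
      simp only [hA, hB]; rw [← hgA]; ring
    rw [e1]
    simp only [hc, hP, Pi.add_apply, hIinv]
    generalize Complex.exp _ = w
    push_cast
    field_simp
    linear_combination (w * φd τ y * τ) * hI2
  have dB : ∀ y ∈ Icc (-h) h,
      HasDerivWithinAt B (-c * (P y * (B y + g' y * A y))) (Icc (-h) h) y := by
    intro y hy
    have h1 := (hexp 1 y).mul ((hφ τ hτ y hy).sub ((hφd τ hτ y hy).div_const (Complex.I * τ)))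
    refine h1.congr_deriv ?_
    have e1 : B y + g' y * A y = Complex.exp ((1 : ℝ) * (Complex.I * τ * y)) * (2 * φ τ y) := by
      simp only [hA, hB]; rw [← hgB]; ring
    rw [e1]
    simp only [hc, hP, Pi.sub_apply, hIinv]
    generalize Complex.exp _ = w
    push_cast
    field_simp
    linear_combination (w * φd τ y * τ) * hI2
  obtain ⟨i1, i2⟩ := hinit τ hτ
  have hcore := core_est A B g g' P c s h (d ^ 2) W (K / ‖τ‖) hh (by positivity) hW0 dA dB
    (by
      intro y hy
      have := hq_bdd y hy
      simp only [hP]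
      rw [Complex.norm_real, Real.norm_eq_abs, abs_le]
      constructor <;> nlinarith)
    (by
      intro y hy
      have := exp_bd τ T h y (-2) hτT hy
      simpa [hg, hWd] using this)
    (by
      intro y hy
      have := exp_bd τ T h y 2 hτT hy
      simpa [hg', hWd] using this)
    (by rw [hg]; fun_prop) hPi
    (by simp [hA, i1, i2, hs, hr]) (by simp [hB, i1, i2, hs, hr])
    (by
      rw [← hL, hcn, div_mul_eq_mul_div, div_le_div_iff₀ (by positivity) (by positivity)]
      linarith)
    (hK τ hτ hτT) x hx
  rw [← hL] at hcore
  have hb : 2 * ‖c‖ ^ 2 * L ^ 2 * ‖s‖ + ‖c‖ * ‖s‖ * (K / ‖τ‖) ≤ (L ^ 2 + K) / ‖τ‖ ^ 2 := by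
    have : 2 * ‖c‖ ^ 2 * L ^ 2 * ‖s‖ + ‖c‖ * ‖s‖ * (K / ‖τ‖)
        ≤ 2 * ‖c‖ ^ 2 * L ^ 2 * 2 + ‖c‖ * 2 * (K / ‖τ‖) := by gcongr
    refine this.trans (le_of_eq ?_)
    rw [hcn]; field_simp
  have hint : ((∫ y in (0 : ℝ)..x, (d ^ 2 - q y) : ℝ) : ℂ) = ∫ y in (0 : ℝ)..x, P y := by
    simp only [hP]
    exact intervalIntegral.integral_ofReal.symm
  have hAx : φ τ x + φd τ x / (Complex.I * τ) = Complex.exp (Complex.I * τ * x) * A x := by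
    simp only [hA]
    rw [← mul_assoc, ← Complex.exp_add]
    have : Complex.I * τ * x + ((-1 : ℝ) : ℂ) * (Complex.I * τ * x) = 0 := by push_cast; ring
    rw [this, Complex.exp_zero, one_mul]
  have hV := exp_bd τ T h x 1 hτT hx
  rw [Complex.ofReal_one, one_mul, abs_one] at hV
  rw [hint, hAx, add_comm (τ ^ 2) ((d : ℂ) ^ 2)]
  have : Complex.exp (Complex.I * τ * x) * A x -
      s * (1 + c * ∫ y in (0 : ℝ)..x, P y) * Complex.exp (Complex.I * τ * x)
      = Complex.exp (Complex.I * τ * x) * (A x - s * (1 + c * ∫ y in (0 : ℝ)..x, P y)) := by ring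
  rw [this, norm_mul, mul_div_assoc]
  exact mul_le_mul hV (hcore.trans hb) (norm_nonneg _) hV0.le
end
end

section
/- Let T > 0, h > 0, d > 0, and let q : [−h, h] → ℝ be measurable with 0 ≤ q(x) ≤ d². For τ ∈ ℂ with |τ| ≥ d and |Im τ| ≤ T, set λ = d² + τ², and let φ : [−h, h] → ℂ be the solution of φ'' + (λ − q(x)) φ = 0 with either the initial conditions φ(0) = 1, φ'(0) = 0, or φ(0) = 0, φ'(0) = √λ (principal branch). Then for all x ∈ [−h, h], |φ(x)| ≤ √2 · cosh((Im τ) h) · exp( d · sinh(T h) / T ). -/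
open MeasureTheory Set Complex
open scoped ENNReal NNReal

noncomputable section

theorem aux_cos (z : ℂ) : ‖Complex.cos z‖ ≤ Real.cosh z.im := by
  rw [Complex.cos, Real.cosh_eq, norm_div]
  have := norm_add_le (Complex.exp (z * I)) (Complex.exp (-z * I))
  rw [Complex.norm_exp, Complex.norm_exp] at this
  simp at this ⊢
  linarith

theorem aux_sin (z : ℂ) : ‖Complex.sin z‖ ≤ Real.cosh z.im := by
  rw [Complex.sin, Real.cosh_eq, norm_div, norm_mul]
  have := norm_sub_le (Complex.exp (-z * I)) (Complex.exp (z * I))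
  rw [Complex.norm_exp, Complex.norm_exp] at this
  simp at this ⊢
  linarith

theorem aux_gronwall (T h d a : ℝ) (hT : 0 < T) (hh : 0 < h) (hd : 0 < d) (ha : 0 ≤ a)
    (u : ℝ → ℝ) (hu : Continuous u)
    (hle : ∀ x ∈ Set.Icc 0 h, u x ≤ a + ∫ s in (0:ℝ)..x, d * Real.cosh (T * (h - s)) * u s) :
    ∀ x ∈ Set.Icc 0 h, u x ≤ a * Real.exp (d * Real.sinh (T * h) / T) := by
  set U : ℝ → ℝ := fun x => a + ∫ s in (0:ℝ)..x, d * Real.cosh (T * (h - s)) * u s with hU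
  set K : ℝ → ℝ := fun x => d * (Real.sinh (T * h) - Real.sinh (T * (h - x))) / T with hK
  have hUd : ∀ x, HasDerivAt U (d * Real.cosh (T * (h - x)) * u x) x := by
    intro x
    have hc : Continuous (fun s => d * Real.cosh (T * (h - s)) * u s) := by fun_prop
    exact (hc.integral_hasStrictDerivAt 0 x).hasDerivAt.const_add a
  have hKd : ∀ x, HasDerivAt K (d * Real.cosh (T * (h - x))) x := by
    intro x
    have h1 : HasDerivAt (fun x : ℝ => T * (h - x)) (T * (-1)) x :=
      ((hasDerivAt_id x).const_sub h).const_mul T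
    refine (((h1.sinh.const_sub (Real.sinh (T * h))).const_mul d).div_const T).congr_deriv ?_
    field_simp
    try ring
  have hWd : ∀ x, HasDerivAt (fun x => U x * Real.exp (-K x))
      (d * Real.cosh (T * (h - x)) * (u x - U x) * Real.exp (-K x)) x := by
    intro x
    refine ((hUd x).mul (hKd x).fun_neg.exp).congr_deriv ?_
    ring
  have hanti : AntitoneOn (fun x => U x * Real.exp (-K x)) (Set.Icc 0 h) := by
    apply antitoneOn_of_deriv_nonpos (convex_Icc 0 h)
    · exact fun x _ => (hWd x).continuousAt.continuousWithinAt
    · exact fun x _ => (hWd x).differentiableAt.differentiableWithinAt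
    · intro x hx
      rw [interior_Icc] at hx
      rw [(hWd x).deriv]
      have h1 := hle x (Set.Ioo_subset_Icc_self hx)
      have h2 : u x - U x ≤ 0 := by simp only [hU]; linarith
      have := Real.cosh_pos (T * (h - x))
      exact mul_nonpos_of_nonpos_of_nonneg
        (mul_nonpos_of_nonneg_of_nonpos (by positivity) h2) (Real.exp_pos _).le
  intro x hx
  have h1 := hanti (Set.left_mem_Icc.2 hh.le) hx hx.1
  have h0 : U 0 * Real.exp (-K 0) = a := by simp [hU, hK]
  simp only [h0] at h1
  have h2 : U x ≤ a * Real.exp (K x) := by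
    rw [Real.exp_neg] at h1
    have := Real.exp_pos (K x)
    rwa [← div_eq_mul_inv, div_le_iff₀ this] at h1
  refine (hle x hx).trans (h2.trans ?_)
  have : 0 ≤ Real.sinh (T * (h - x)) :=
    Real.sinh_nonneg_iff.2 (mul_nonneg hT.le (by linarith [hx.2]))
  gcongr
  simp only [hK]
  gcongr
  linarith

theorem aux_half (T h d : ℝ) (hT : 0 < T) (hh : 0 < h) (hd : 0 < d)
    (q : ℝ → ℝ)
    (hq_bdd : ∀ x ∈ Set.Icc 0 h, 0 ≤ q x ∧ q x ≤ d ^ 2)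
    (τ : ℂ) (hτ_abs : d ≤ ‖τ‖) (hτ_im : |τ.im| ≤ T)
    (φ φd : ℝ → ℂ)
    (hφ : ∀ x ∈ Set.Icc 0 h, HasDerivWithinAt φ (φd x) (Set.Icc 0 h) x)
    (hφd : ∀ x ∈ Set.Icc 0 h,
      HasDerivWithinAt φd
        (-((((d : ℂ) ^ 2 + τ ^ 2) - ((q x : ℝ) : ℂ)) * φ x)) (Set.Icc 0 h) x)
    (hinit : (‖φ 0‖ ≤ Real.sqrt 2 ∧ φd 0 = 0) ∨
      (φ 0 = 0 ∧ ‖φd 0‖ ≤ Real.sqrt 2 * ‖τ‖)) :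
    ∀ x ∈ Set.Icc 0 h,
      ‖φ x‖ ≤ Real.sqrt 2 * Real.cosh (τ.im * h) * Real.exp (d * Real.sinh (T * h) / T) := by
  have hτp : 0 < ‖τ‖ := hd.trans_le hτ_abs
  have hτ0 : τ ≠ 0 := norm_pos_iff.1 hτp
  have hφc : ContinuousOn φ (Set.Icc 0 h) := fun x hx => (hφ x hx).continuousWithinAt
  set u : ℝ → ℝ := fun s => ‖φ (max 0 (min s h))‖ with hu
  have huc : Continuous u := by
    apply Continuous.norm
    apply hφc.comp_continuous (by fun_prop)
    intro x
    exact ⟨le_max_left _ _, max_le hh.le (min_le_right _ _)⟩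
  have hueq : ∀ x ∈ Set.Icc 0 h, u x = ‖φ x‖ := by
    intro x hx
    simp only [hu, min_eq_left hx.2, max_eq_right hx.1]
  have hcoshpos := Real.cosh_pos (τ.im * h)
  have key := aux_gronwall T h d (Real.sqrt 2 * Real.cosh (τ.im * h)) hT hh hd (by positivity)
    u huc ?_
  · intro x hx
    rw [← hueq x hx]
    exact key x hx
  intro x hx
  rw [hueq x hx]
  set G : ℝ → ℂ := fun s => φ s * Complex.cos (τ * (x - s)) + φd s * (Complex.sin (τ * (x - s)) / τ)
    with hG
  have hGd : ∀ s ∈ Set.Icc 0 h, HasDerivWithinAt G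
      (-(((d ^ 2 - q s : ℝ) : ℂ) * φ s * (Complex.sin (τ * (x - s)) / τ))) (Set.Icc 0 h) s := by
    intro s hs
    have h1 : HasDerivAt (fun s : ℂ => τ * ((x : ℂ) - s)) (τ * (-1)) (s : ℂ) :=
      ((hasDerivAt_id (s : ℂ)).const_sub (x : ℂ)).const_mul τ
    have h2 := ((hφ s hs).mul h1.ccos.comp_ofReal.hasDerivWithinAt).add
      ((hφd s hs).mul (h1.csin.div_const τ).comp_ofReal.hasDerivWithinAt)
    refine h2.congr_deriv ?_
    push_cast
    field_simp
    ring
  have hB : ∀ s, HasDerivAt (fun y => Real.sqrt 2 * Real.cosh (τ.im * h) +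
      ∫ s in (0:ℝ)..y, d * Real.cosh (T * (h - s)) * u s) (d * Real.cosh (T * (h - s)) * u s) s := by
    intro s
    have hc : Continuous (fun s => d * Real.cosh (T * (h - s)) * u s) := by fun_prop
    exact (hc.integral_hasStrictDerivAt 0 s).hasDerivAt.const_add _
  have hGx : G x = φ x := by simp [hG]
  have hsub : Set.Icc 0 x ⊆ Set.Icc 0 h := Set.Icc_subset_Icc_right hx.2
  have him : ∀ s : ℝ, (τ * ((x : ℂ) - s)).im = τ.im * (x - s) := by
    intro s; simp [Complex.mul_im]
  have hch : Real.cosh (τ.im * x) ≤ Real.cosh (τ.im * h) := by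
    rw [Real.cosh_le_cosh, abs_mul, abs_mul, abs_of_nonneg hx.1, abs_of_pos hh]
    gcongr
    exact hx.2
  have main := image_norm_le_of_norm_deriv_right_le_deriv_boundary (f := G)
    (f' := fun s => (-(((d ^ 2 - q s : ℝ) : ℂ) * φ s * (Complex.sin (τ * (x - s)) / τ))))
    (a := 0) (b := x) (fun s hs => ((hGd s (hsub hs)).continuousWithinAt).mono hsub)
    ?_ (?_) hB ?_ (Set.right_mem_Icc.2 hx.1)
  · rwa [hGx] at main
  · intro s hs
    exact (hGd s (hsub (Set.Ico_subset_Icc_self hs))).mono_of_mem_nhdsWithin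
      (Icc_mem_nhdsGE_of_mem ⟨hs.1, hs.2.trans_le hx.2⟩)
  · simp only [intervalIntegral.integral_same, add_zero, hG]
    have hi := him 0
    have hc0 := (aux_cos (τ * ((x : ℂ) - (0 : ℝ))))
    have hs0 := (aux_sin (τ * ((x : ℂ) - (0 : ℝ))))
    rw [hi, sub_zero] at hc0 hs0
    rcases hinit with ⟨h1, h2⟩ | ⟨h1, h2⟩
    · rw [h2, zero_mul, add_zero, norm_mul]
      exact mul_le_mul h1 (hc0.trans hch) (norm_nonneg _) (by positivity)
    · rw [h1, zero_mul, zero_add, norm_mul, norm_div, mul_div_left_comm, mul_comm]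
      exact mul_le_mul ((div_le_iff₀ hτp).2 h2) (hs0.trans hch) (norm_nonneg _) (by positivity)
  · intro s hs
    have hs' := hsub (Set.Ico_subset_Icc_self hs)
    rw [hueq s hs', norm_neg, norm_mul, norm_mul, norm_div, Complex.norm_real, Real.norm_eq_abs]
    obtain ⟨q0, q1⟩ := hq_bdd s hs'
    have hp : |d ^ 2 - q s| ≤ d ^ 2 := by rw [abs_le]; constructor <;> nlinarith
    have hsn := aux_sin (τ * ((x : ℂ) - s))
    rw [him] at hsn
    have hc2 : Real.cosh (τ.im * (x - s)) ≤ Real.cosh (T * (h - s)) := by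
      have e1 : 0 ≤ x - s := by linarith [hs.2]
      have e2 : 0 ≤ h - s := by linarith [hs'.2]
      rw [Real.cosh_le_cosh, abs_mul, abs_mul, abs_of_nonneg e1, abs_of_nonneg e2, abs_of_pos hT]
      have := hx.2
      gcongr
    calc |d ^ 2 - q s| * ‖φ s‖ * (‖Complex.sin (τ * (x - s))‖ / ‖τ‖)
        ≤ d ^ 2 * ‖φ s‖ * (Real.cosh (T * (h - s)) / d) := by
          have := hsn.trans hc2
          have := Real.cosh_pos (T * (h - s))
          gcongr
      _ = _ := by field_simp

/-- **A priori bound for the fundamental solutions (large `|τ|`).**  Let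
`0 ≤ q ≤ d²` on `[-h,h]` and `λ = d² + τ²` with `|τ| ≥ d`, `|Im τ| ≤ T`.  If `φ` solves
`φ'' + (λ - q(x))φ = 0` on `[-h,h]` (with derivative `φd`) with either `φ(0)=1, φ'(0)=0`
or `φ(0)=0, φ'(0)=√λ` (principal branch), then
`|φ(x)| ≤ √2 cosh((Im τ)h) exp(d sinh(Th)/T)` for all `x ∈ [-h,h]`. -/
theorem fundamental_solution_bound_large_tau
    (T h d : ℝ) (hT : 0 < T) (hh : 0 < h) (hd : 0 < d)
    (q : ℝ → ℝ) (hq_meas : Measurable q)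
    (hq_bdd : ∀ x ∈ Set.Icc (-h) h, 0 ≤ q x ∧ q x ≤ d ^ 2)
    (τ : ℂ) (hτ_abs : d ≤ ‖τ‖) (hτ_im : |τ.im| ≤ T)
    (φ φd : ℝ → ℂ)
    (hφ : ∀ x ∈ Set.Icc (-h) h, HasDerivWithinAt φ (φd x) (Set.Icc (-h) h) x)
    (hφd : ∀ x ∈ Set.Icc (-h) h,
      HasDerivWithinAt φd
        (-((((d : ℂ) ^ 2 + τ ^ 2) - ((q x : ℝ) : ℂ)) * φ x)) (Set.Icc (-h) h) x)
    (hinit : (φ 0 = 1 ∧ φd 0 = 0) ∨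
      (φ 0 = 0 ∧ φd 0 = ((d : ℂ) ^ 2 + τ ^ 2) ^ ((1 : ℂ) / 2))) :
    ∀ x ∈ Set.Icc (-h) h,
      ‖φ x‖ ≤ Real.sqrt 2 * Real.cosh (τ.im * h) * Real.exp (d * Real.sinh (T * h) / T) := by
  have hτp : 0 < ‖τ‖ := hd.trans_le hτ_abs
  have hinit2 : (‖φ 0‖ ≤ Real.sqrt 2 ∧ φd 0 = 0) ∨
      (φ 0 = 0 ∧ ‖φd 0‖ ≤ Real.sqrt 2 * ‖τ‖) := by
    rcases hinit with ⟨h1, h2⟩ | ⟨h1, h2⟩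
    · left
      refine ⟨?_, h2⟩
      rw [h1, norm_one]
      exact Real.one_le_sqrt.2 (by norm_num)
    · right
      refine ⟨h1, ?_⟩
      have hsq : φd 0 ^ 2 = (d : ℂ) ^ 2 + τ ^ 2 := by
        rw [h2, one_div]
        have := Complex.cpow_nat_inv_pow ((d : ℂ) ^ 2 + τ ^ 2) (n := 2) two_ne_zero
        rwa [Nat.cast_ofNat] at this
      have hn : ‖φd 0‖ ^ 2 ≤ 2 * ‖τ‖ ^ 2 := by
        rw [← norm_pow, hsq]
        refine (norm_add_le _ _).trans ?_
        rw [norm_pow, norm_pow, Complex.norm_real, Real.norm_eq_abs, sq_abs]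
        nlinarith
      refine (pow_le_pow_iff_left₀ (norm_nonneg _) (by positivity) two_ne_zero).1 ?_
      rw [mul_pow, Real.sq_sqrt (by norm_num)]
      exact hn
  intro x hx
  rcases le_total 0 x with h0 | h0
  · have hsub : Set.Icc 0 h ⊆ Set.Icc (-h) h := Set.Icc_subset_Icc_left (by linarith)
    exact aux_half T h d hT hh hd q (fun x hx => hq_bdd x (hsub hx)) τ hτ_abs hτ_im φ φd
      (fun x hx => (hφ x (hsub hx)).mono hsub) (fun x hx => (hφd x (hsub hx)).mono hsub)
      hinit2 x ⟨h0, hx.2⟩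
  · have hmaps : Set.MapsTo (fun x : ℝ => -x) (Set.Icc 0 h) (Set.Icc (-h) h) := by
      intro y hy
      exact ⟨by linarith [hy.2], by linarith [hy.1]⟩
    have hneg : ∀ y, HasDerivWithinAt (fun x : ℝ => -x) (-1) (Set.Icc 0 h) y :=
      fun y => (hasDerivAt_neg y).hasDerivWithinAt
    have := aux_half T h d hT hh hd (fun x => q (-x)) (fun x hx => hq_bdd _ (hmaps hx)) τ
      hτ_abs hτ_im (fun x => φ (-x)) (fun x => -φd (-x)) ?_ ?_ ?_ (-x)
      ⟨by linarith, by linarith [hx.1]⟩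
    · simpa using this
    · intro y hy
      have := (hφ (-y) (hmaps hy)).scomp y (hneg y) hmaps
      simpa [Function.comp_def] using this
    · intro y hy
      have := ((hφd (-y) (hmaps hy)).scomp y (hneg y) hmaps).neg
      refine this.congr_deriv ?_
      simp
    · simpa using hinit2
end
end

section
/- Let h > 0, let p : [−h, h] → ℝ be continuously differentiable, let τ ∈ ℂ \ {0}, and let φ : [−h, h] → ℂ be a solution of φ''(y) + (τ² + p(y)) φ(y) = 0 on [−h, h]; set Φ(y) = φ(y) + φ'(y)/(iτ). Then for every x ∈ [−h, h]: Φ(x) e^{−iτx} = Φ(0) + (i/(2τ)) ∫₀^x e^{−iτy} p(y) Φ(y) dy + (1/(2τ²)) [ ∫₀^x e^{−iτy} p'(y) φ(y) dy − e^{−iτx} p(x) φ(x) + p(0) φ(0) ]. -/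
open MeasureTheory Set Complex
open scoped ENNReal NNReal

noncomputable section

/-- **Key integral identity for `Φ`.**  Let `p` be continuously differentiable on
`[-h,h]` (with derivative `pd`), `τ ≠ 0`, and let `φ` solve `φ'' + (τ² + p(y))φ = 0` on
`[-h,h]` (with derivative `φd`).  Setting `Φ(y) = φ(y) + φ'(y)/(iτ)`, for every
`x ∈ [-h,h]`:
`Φ(x)e^{-iτx} = Φ(0) + (i/(2τ)) ∫₀ˣ e^{-iτy} p(y) Φ(y) dy`
`+ (1/(2τ²)) [∫₀ˣ e^{-iτy} p'(y) φ(y) dy - e^{-iτx} p(x) φ(x) + p(0) φ(0)]`. -/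
theorem Phi_integral_identity
    (h : ℝ) (hh : 0 < h) (p pd : ℝ → ℝ)
    (hp : ∀ y ∈ Set.Icc (-h) h, HasDerivWithinAt p (pd y) (Set.Icc (-h) h) y)
    (hpd : ContinuousOn pd (Set.Icc (-h) h))
    (τ : ℂ) (hτ : τ ≠ 0) (φ φd : ℝ → ℂ)
    (hφ : ∀ y ∈ Set.Icc (-h) h, HasDerivWithinAt φ (φd y) (Set.Icc (-h) h) y)
    (hφd : ∀ y ∈ Set.Icc (-h) h,
      HasDerivWithinAt φd (-((τ ^ 2 + ((p y : ℝ) : ℂ)) * φ y)) (Set.Icc (-h) h) y) :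
    ∀ x ∈ Set.Icc (-h) h,
      (φ x + φd x / (Complex.I * τ)) * Complex.exp (-(Complex.I * τ * (x : ℂ))) =
        (φ 0 + φd 0 / (Complex.I * τ)) +
        (Complex.I / (2 * τ)) *
          (∫ y in (0 : ℝ)..x, Complex.exp (-(Complex.I * τ * (y : ℂ))) *
            ((p y : ℝ) : ℂ) * (φ y + φd y / (Complex.I * τ))) +
        (1 / (2 * τ ^ 2)) *
          ((∫ y in (0 : ℝ)..x, Complex.exp (-(Complex.I * τ * (y : ℂ))) *
              ((pd y : ℝ) : ℂ) * φ y) -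
            Complex.exp (-(Complex.I * τ * (x : ℂ))) * ((p x : ℝ) : ℂ) * φ x +
            ((p 0 : ℝ) : ℂ) * φ 0) := by
  intro x hx
  have h0 : (0 : ℝ) ∈ Set.Icc (-h) h := ⟨by linarith, hh.le⟩
  have hsub : Set.uIcc 0 x ⊆ Set.Icc (-h) h := Set.uIcc_subset_Icc h0 hx
  have hI : Complex.I ≠ 0 := Complex.I_ne_zero
  have hI2 : Complex.I ^ 2 = -1 := Complex.I_sq
  have he : ∀ y : ℝ, HasDerivAt (fun y : ℝ => Complex.exp (-(Complex.I * τ * (y : ℂ))))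
      (Complex.exp (-(Complex.I * τ * (y : ℂ))) * (-(Complex.I * τ * 1))) y := fun y =>
    (((hasDerivAt_id y).ofReal_comp.const_mul (Complex.I * τ)).neg).cexp
  have hpc : ∀ y ∈ Set.Icc (-h) h, HasDerivWithinAt (fun y => ((p y : ℝ) : ℂ))
      ((pd y : ℝ) : ℂ) (Set.Icc (-h) h) y := fun y hy => (hp y hy).ofReal_comp
  have cp : ContinuousOn (fun y => ((p y : ℝ) : ℂ)) (Set.Icc (-h) h) :=
    fun y hy => (hpc y hy).continuousWithinAt
  have cφ : ContinuousOn φ (Set.Icc (-h) h) := fun y hy => (hφ y hy).continuousWithinAt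
  have cφd : ContinuousOn φd (Set.Icc (-h) h) := fun y hy => (hφd y hy).continuousWithinAt
  have cpd : ContinuousOn (fun y => ((pd y : ℝ) : ℂ)) (Set.Icc (-h) h) :=
    Complex.continuous_ofReal.comp_continuousOn hpd
  have ce : ContinuousOn (fun y : ℝ => Complex.exp (-(Complex.I * τ * (y : ℂ))))
      (Set.Icc (-h) h) := fun y _ => (he y).continuousAt.continuousWithinAt
  have i1 : IntervalIntegrable (fun y : ℝ => Complex.exp (-(Complex.I * τ * (y : ℂ))) *
            ((p y : ℝ) : ℂ) * (φ y + φd y / (Complex.I * τ))) volume 0 x :=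
    (((ce.mul cp).mul (cφ.add (cφd.div_const _))).mono hsub).intervalIntegrable
  have i2 : IntervalIntegrable (fun y : ℝ => Complex.exp (-(Complex.I * τ * (y : ℂ))) *
            ((pd y : ℝ) : ℂ) * φ y) volume 0 x :=
    (((ce.mul cpd).mul cφ).mono hsub).intervalIntegrable
  have hG : ∀ y ∈ Set.Icc (-h) h, HasDerivWithinAt
      (fun y : ℝ => (φ y + φd y / (Complex.I * τ)) * Complex.exp (-(Complex.I * τ * (y : ℂ))) +
        (1 / (2 * τ ^ 2)) * (Complex.exp (-(Complex.I * τ * (y : ℂ))) * ((p y : ℝ) : ℂ) * φ y))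
      ((Complex.I / (2 * τ)) * (Complex.exp (-(Complex.I * τ * (y : ℂ))) *
            ((p y : ℝ) : ℂ) * (φ y + φd y / (Complex.I * τ))) +
        (1 / (2 * τ ^ 2)) * (Complex.exp (-(Complex.I * τ * (y : ℂ))) *
            ((pd y : ℝ) : ℂ) * φ y)) (Set.Icc (-h) h) y := by
    intro y hy
    have e1 := (he y).hasDerivWithinAt (s := Set.Icc (-h) h)
    have := (((hφ y hy).add ((hφd y hy).div_const (Complex.I * τ))).mul e1).add
      (((e1.mul (hpc y hy)).mul (hφ y hy)).const_mul (1 / (2 * τ ^ 2)))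
    refine this.congr_deriv ?_
    simp only [Pi.add_apply, Pi.mul_apply]
    generalize Complex.exp (-(Complex.I * τ * (y : ℂ))) = E
    have hd : ∀ z : ℂ, z / (Complex.I * τ) = -Complex.I * z / τ := by
      intro z
      field_simp
      linear_combination z * hI2
    simp only [hd]
    field_simp
    ring_nf
    simp only [hI2]
    ring
  have key := intervalIntegral.integral_eq_sub_of_hasDeriv_right
    (fun y hy => ((hG y (hsub hy)).continuousWithinAt.mono hsub))
    (fun y hy => by
      have hy1 : -h < y := lt_of_le_of_lt (le_min h0.1 hx.1) hy.1
      have hy2 : y < h := lt_of_lt_of_le hy.2 (max_le h0.2 hx.2)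
      exact ((hG y ⟨hy1.le, hy2.le⟩).hasDerivAt (Icc_mem_nhds hy1 hy2)).hasDerivWithinAt)
    ((i1.const_mul (Complex.I / (2 * τ))).add (i2.const_mul (1 / (2 * τ ^ 2))))
  rw [intervalIntegral.integral_add (i1.const_mul _) (i2.const_mul _),
    intervalIntegral.integral_const_mul, intervalIntegral.integral_const_mul] at key
  simp only [Complex.ofReal_zero, mul_zero, neg_zero, Complex.exp_zero, mul_one, one_mul] at key
  linear_combination -key
end
end
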